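/- arXiv:1109.2067 — 10 statements merged into one kernel-verified Lean document; each statement's English description precedes it below -/
import Mathlib

section
/- Fix n (a perfect 20th power, sufficiently large) and set t = n^(1/5), r = n^(3/20), γ = n^(-1/10), v = n^(-7/10). Let (V,S,T) be an admissible triple, and let α be a real number with n^(-1/20) ≤ α ≤ 1. Then for every input y ⊆ [n], the welfare of the allocation returned by the algorithm A_{V,S,T,α} on input y is at least (α/6) times the maximum welfare on input y over the three feasible allocations x_S^1, x_T^α, x_{[n]}^γ. (That is, approx_{F_{V,S,T,α}}(A_{V,S,T,α}) ≥ α/6.) -/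
/-!
Statement 0: the algorithm `A_{V,S,T,α}` is an `α/6`-approximation for the welfare
maximization problem with feasible set `F_{V,S,T,α} = {x_S^1, x_T^α, x_{[n]}^γ}`,
where `n = m^20`, `t = m^4`, `r = m^3`, `γ = m^{-2}`, `v = m^{-14}`.
-/

open Finset
open scoped Classical

noncomputable section

/-- The allocation `x_W^a` giving `a` to each agent in `W` and `0` to all others. -/
def alloc {n : ℕ} (W : Finset (Fin n)) (a : ℝ) : Fin n → ℝ :=
  fun i => if i ∈ W then a else 0

/-- Welfare of allocation `x` on input `y`: agents in `y` have value `1`,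
agents outside `y` have value `v`. -/
def welfare {n : ℕ} (v : ℝ) (y : Finset (Fin n)) (x : Fin n → ℝ) : ℝ :=
  ∑ i ∈ y, x i + v * ∑ i ∈ yᶜ, x i

/-- `n_T(y) = |y ∩ T| + |y ∩ U|` where `U = S ∩ T`. -/
def nTcount {n : ℕ} (S T y : Finset (Fin n)) : ℕ :=
  (y ∩ T).card + (y ∩ (S ∩ T)).card

/-- `n_S(y) = |y ∩ S| + 2|y ∩ V|`. -/
def nScount {n : ℕ} (S V y : Finset (Fin n)) : ℕ :=
  (y ∩ S).card + 2 * (y ∩ V).card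

/-- The algorithm `A_{V,S,T,α}` with threshold `t` and default level `γ`. -/
def algo {n : ℕ} (V S T : Finset (Fin n)) (α γ : ℝ) (t : ℕ)
    (y : Finset (Fin n)) : Fin n → ℝ :=
  if t ≤ nScount S V y ∧ γ * y.card ≤ (nScount S V y : ℝ) ∧
      nTcount S T y ≤ nScount S V y then
    alloc S 1
  else if t ≤ nTcount S T y ∧ γ * y.card ≤ (nTcount S T y : ℝ) ∧
      nScount S V y ≤ nTcount S T y then
    alloc T α
  else
    alloc Finset.univ γ

lemma welfare_alloc {n : ℕ} (v a : ℝ) (y W : Finset (Fin n)) :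
    welfare v y (alloc W a) = a * (y ∩ W).card + v * (a * (yᶜ ∩ W).card) := by
  unfold welfare alloc
  simp only [Finset.sum_ite_mem, Finset.sum_const, nsmul_eq_mul]
  ring

/-- For `n = m^20` sufficiently large, for every admissible triple `(V,S,T)` and every
`α ∈ [n^{-1/20}, 1]`, on every input `y` the welfare obtained by `A_{V,S,T,α}` is at
least `α/6` times the best welfare among the three feasible allocations. -/
theorem stmt0 :
    ∃ n₀ : ℕ, ∀ m : ℕ, n₀ ≤ m →
      ∀ (V S T : Finset (Fin (m ^ 20))) (α : ℝ),
        S.card = m ^ 13 → T.card = m ^ 13 → (S ∩ T).card = m ^ 10 →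
        V ⊆ S ∩ T → V.card = m ^ 7 →
        ((m : ℝ))⁻¹ ≤ α → α ≤ 1 →
        ∀ y : Finset (Fin (m ^ 20)),
          α / 6 *
              max (welfare (((m : ℝ) ^ 14)⁻¹) y (alloc S 1))
                (max (welfare (((m : ℝ) ^ 14)⁻¹) y (alloc T α))
                  (welfare (((m : ℝ) ^ 14)⁻¹) y (alloc Finset.univ (((m : ℝ) ^ 2)⁻¹))))
            ≤ welfare (((m : ℝ) ^ 14)⁻¹) y
                (algo V S T α (((m : ℝ) ^ 2)⁻¹) (m ^ 4) y) := by
  refine ⟨1, ?_⟩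
  intro m hm V S T α hS hT hU hV hVc hα hα1 y
  have hM : (1 : ℝ) ≤ m := by exact_mod_cast hm
  have hM0 : (0 : ℝ) < m := by linarith
  have hα0 : 0 < α := lt_of_lt_of_le (inv_pos.mpr hM0) hα
  set v : ℝ := ((m : ℝ) ^ 14)⁻¹ with hv
  set γ : ℝ := ((m : ℝ) ^ 2)⁻¹ with hγ
  have hv0 : 0 < v := by positivity
  have hγ0 : 0 < γ := by positivity
  have hv1 : v ≤ 1 := inv_le_one_of_one_le₀ (one_le_pow₀ hM)
  have hγ1 : γ ≤ 1 := inv_le_one_of_one_le₀ (one_le_pow₀ hM)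
  have hv13 : v * (m : ℝ) ^ 13 ≤ 1 := by
    have h1 : (m : ℝ) ^ 13 ≤ (m : ℝ) ^ 14 := pow_le_pow_right₀ hM (by norm_num)
    calc v * (m : ℝ) ^ 13 ≤ v * (m : ℝ) ^ 14 := by gcongr
      _ = 1 := by rw [hv]; field_simp
  have hv20 : v * (γ * (m : ℝ) ^ 20) = (m : ℝ) ^ 4 := by
    rw [hv, hγ]; field_simp
  have ht1 : (1 : ℝ) ≤ (m : ℝ) ^ 4 := one_le_pow₀ hM
  -- counts
  have hsc : v * ((yᶜ ∩ S).card : ℝ) ≤ 1 := by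
    have h : ((yᶜ ∩ S).card : ℝ) ≤ (m : ℝ) ^ 13 := by
      have := Finset.card_le_card (Finset.inter_subset_right : yᶜ ∩ S ⊆ S)
      rw [hS] at this; exact_mod_cast this
    calc _ ≤ v * (m : ℝ) ^ 13 := by gcongr
      _ ≤ 1 := hv13
  have htc : v * ((yᶜ ∩ T).card : ℝ) ≤ 1 := by
    have h : ((yᶜ ∩ T).card : ℝ) ≤ (m : ℝ) ^ 13 := by
      have := Finset.card_le_card (Finset.inter_subset_right : yᶜ ∩ T ⊆ T)
      rw [hT] at this; exact_mod_cast this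
    calc _ ≤ v * (m : ℝ) ^ 13 := by gcongr
      _ ≤ 1 := hv13
  have hsc0 : 0 ≤ v * ((yᶜ ∩ S).card : ℝ) := by positivity
  have htc0 : 0 ≤ v * ((yᶜ ∩ T).card : ℝ) := by positivity
  have hkk : (y.card : ℝ) + (yᶜ.card : ℝ) = (m : ℝ) ^ 20 := by
    have := Finset.card_add_card_compl y
    rw [Fintype.card_fin] at this
    exact_mod_cast this
  have hwS : welfare v y (alloc S 1) = (y ∩ S).card + v * ((yᶜ ∩ S).card : ℝ) := by
    rw [welfare_alloc]; ring
  have hwT : welfare v y (alloc T α) = α * ((y ∩ T).card + v * ((yᶜ ∩ T).card : ℝ)) := by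
    rw [welfare_alloc]; ring
  have hwA : welfare v y (alloc Finset.univ γ) = γ * y.card + v * (γ * (yᶜ.card : ℝ)) := by
    rw [welfare_alloc]; simp
  have hc0 : 0 ≤ v * (γ * (yᶜ.card : ℝ)) := by positivity
  have hk0 : 0 ≤ γ * (y.card : ℝ) := by positivity
  have hsum : v * (γ * (y.card : ℝ)) + v * (γ * (yᶜ.card : ℝ)) = (m : ℝ) ^ 4 := by
    rw [← hv20, ← hkk]; ring
  have hvk : v * (γ * (y.card : ℝ)) ≤ γ * y.card := mul_le_of_le_one_left hk0 hv1
  have hvk0 : 0 ≤ v * (γ * (y.card : ℝ)) := by positivity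
  have hus : (y ∩ (S ∩ T)).card ≤ (y ∩ S).card :=
    Finset.card_le_card (Finset.inter_subset_inter_left Finset.inter_subset_left)
  have hut : (y ∩ (S ∩ T)).card ≤ (y ∩ T).card :=
    Finset.card_le_card (Finset.inter_subset_inter_left Finset.inter_subset_right)
  have hwu : (y ∩ V).card ≤ (y ∩ (S ∩ T)).card :=
    Finset.card_le_card (Finset.inter_subset_inter_left hV)
  have hnS : (nScount S V y : ℝ) = (y ∩ S).card + 2 * (y ∩ V).card := by
    unfold nScount; push_cast; ring
  have hnT : (nTcount S T y : ℝ) = (y ∩ T).card + (y ∩ (S ∩ T)).card := by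
    unfold nTcount; push_cast; ring
  have hus' : ((y ∩ (S ∩ T)).card : ℝ) ≤ (y ∩ S).card := by exact_mod_cast hus
  have hut' : ((y ∩ (S ∩ T)).card : ℝ) ≤ (y ∩ T).card := by exact_mod_cast hut
  have hwu' : ((y ∩ V).card : ℝ) ≤ (y ∩ (S ∩ T)).card := by exact_mod_cast hwu
  have hw0 : (0 : ℝ) ≤ (y ∩ V).card := by positivity
  have hTle : welfare v y (alloc T α) ≤ (y ∩ T).card + 1 := by
    rw [hwT]
    have : α * ((y ∩ T).card + v * ((yᶜ ∩ T).card : ℝ)) ≤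
        (y ∩ T).card + v * ((yᶜ ∩ T).card : ℝ) := mul_le_of_le_one_left (by positivity) hα1
    linarith
  -- the general reduction
  have key : ∀ B R : ℝ, welfare v y (alloc S 1) ≤ B → welfare v y (alloc T α) ≤ B →
      welfare v y (alloc Finset.univ γ) ≤ B → α / 6 * B ≤ R →
      α / 6 * max (welfare v y (alloc S 1)) (max (welfare v y (alloc T α))
        (welfare v y (alloc Finset.univ γ))) ≤ R := by
    intro B R h1 h2 h3 h4
    refine le_trans ?_ h4
    have : max (welfare v y (alloc S 1)) (max (welfare v y (alloc T α))
        (welfare v y (alloc Finset.univ γ))) ≤ B := max_le h1 (max_le h2 h3)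
    gcongr
  unfold algo
  split_ifs with c1 c2
  · obtain ⟨a1, a2, a3⟩ := c1
    have a1' : (m : ℝ) ^ 4 ≤ nScount S V y := by exact_mod_cast a1
    have a3' : (nTcount S T y : ℝ) ≤ nScount S V y := by exact_mod_cast a3
    have hB : α / 6 * (6 * ((y ∩ S).card : ℝ)) ≤ (y ∩ S).card := by
      have : α * ((y ∩ S).card : ℝ) ≤ (y ∩ S).card := mul_le_of_le_one_left (by positivity) hα1
      linarith
    have hs1 : (1 : ℝ) ≤ (y ∩ S).card := by
      have : 0 < (y ∩ S).card := by
        have : (0 : ℝ) < (y ∩ S).card := by linarith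
        exact_mod_cast this
      exact_mod_cast this
    refine key (6 * (y ∩ S).card) _ ?_ ?_ ?_ ?_ <;> linarith
  · obtain ⟨a1, a2, a3⟩ := c2
    have a1' : (m : ℝ) ^ 4 ≤ nTcount S T y := by exact_mod_cast a1
    have a3' : (nScount S V y : ℝ) ≤ nTcount S T y := by exact_mod_cast a3
    have hB : α / 6 * (6 * ((y ∩ T).card : ℝ)) ≤ welfare v y (alloc T α) := by
      rw [hwT]
      have := mul_nonneg hα0.le htc0
      linarith
    have hs1 : (1 : ℝ) ≤ (y ∩ T).card := by
      have : 0 < (y ∩ T).card := by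
        have : (0 : ℝ) < (y ∩ T).card := by linarith
        exact_mod_cast this
      exact_mod_cast this
    refine key (6 * (y ∩ T).card) _ ?_ ?_ ?_ hB <;> linarith
  · set A := welfare v y (alloc Finset.univ γ) with hA
    have hAt : (m : ℝ) ^ 4 ≤ A := by linarith
    have hAk : γ * y.card ≤ A := by linarith
    have hmax : (nScount S V y : ℝ) ≤ A ∧ (nTcount S T y : ℝ) ≤ A := by
      rcases le_total (nTcount S T y) (nScount S V y) with h | h
      · have h' : (nTcount S T y : ℝ) ≤ nScount S V y := by exact_mod_cast h
        have : (nScount S V y : ℝ) ≤ A := by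
          by_contra hc
          push Not at hc
          refine c1 ⟨?_, by linarith, h⟩
          have : (m : ℝ) ^ 4 ≤ nScount S V y := by linarith
          exact_mod_cast this
        exact ⟨this, by linarith⟩
      · have h' : (nScount S V y : ℝ) ≤ nTcount S T y := by exact_mod_cast h
        have : (nTcount S T y : ℝ) ≤ A := by
          by_contra hc
          push Not at hc
          refine c2 ⟨?_, by linarith, h⟩
          have : (m : ℝ) ^ 4 ≤ nTcount S T y := by linarith
          exact_mod_cast this
        exact ⟨by linarith, this⟩
    obtain ⟨b1, b2⟩ := hmax
    have hu0 : (0 : ℝ) ≤ (y ∩ (S ∩ T)).card := by positivity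
    have hB : α / 6 * (6 * A) ≤ A := by
      have : α * A ≤ A := mul_le_of_le_one_left (by linarith) hα1
      linarith
    refine key (6 * A) _ ?_ ?_ ?_ hB <;> linarith

end
end

section
/- Let V ⊆ U ⊆ [n] and let A' be a randomized allocation rule assigning to each input y ⊆ [n] a probability distribution over allocations in ℝ^n, each of which is constant on U (i.e., assigns the same amount to every agent of U). Suppose A' satisfies the truthfulness-in-expectation monotonicity condition: for every agent i and every y ⊆ [n] with i ∉ y, the expected allocation to agent i under A'(y ∪ {i}) is at least the expected allocation to agent i under A'(y). Then for every agent i ∈ U, the expected allocation to i under A'(U) is at least the expected allocation to i under A'(V). -/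
/-!
Statement 1: if a randomized allocation rule `A'` outputs only allocations that are
constant on `U ⊇ V`, and satisfies the truthfulness-in-expectation per-agent
monotonicity condition, then for every agent `i ∈ U` the expected allocation to `i`
on input `U` is at least the expected allocation to `i` on input `V`.

Randomization is modelled by a finite probability space `(Ω, μ)`.
An input is the set `y` of agents with value `1` (others have value `v`);
raising agent `i`'s value from `v` to `1` corresponds to replacing `y` by `insert i y`.
-/

open Finset

theorem stmt1 (n : ℕ) (v : ℝ) (hv0 : 0 < v) (hv1 : v < 1)
    (V U : Finset (Fin n)) (hVU : V ⊆ U)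
    (Ω : Type) [Fintype Ω] (μ : Ω → ℝ)
    (hμ0 : ∀ ω, 0 ≤ μ ω) (hμ1 : ∑ ω, μ ω = 1)
    (A : Finset (Fin n) → Ω → Fin n → ℝ)
    (hconst : ∀ (y : Finset (Fin n)) (ω : Ω), ∀ i ∈ U, ∀ j ∈ U, A y ω i = A y ω j)
    (hmono : ∀ (i : Fin n) (y : Finset (Fin n)), i ∉ y →
      ∑ ω, μ ω * A y ω i ≤ ∑ ω, μ ω * A (insert i y) ω i) :
    ∀ i ∈ U, ∑ ω, μ ω * A V ω i ≤ ∑ ω, μ ω * A U ω i := by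
  intro i hi
  have key : ∀ W : Finset (Fin n), W ⊆ U →
      ∑ ω, μ ω * A V ω i ≤ ∑ ω, μ ω * A (V ∪ W) ω i := by
    intro W
    induction W using Finset.induction_on with
    | empty => intro _; simp
    | insert j W _ ih =>
      intro hW
      have hj : j ∈ U := hW (Finset.mem_insert_self j W)
      refine (ih (fun x hx => hW (Finset.mem_insert_of_mem hx))).trans ?_
      rw [Finset.union_insert]
      by_cases hjm : j ∈ V ∪ W
      · rw [Finset.insert_eq_of_mem hjm]
      · have h := hmono j (V ∪ W) hjm
        have e : ∀ y : Finset (Fin n), ∑ ω, μ ω * A y ω j = ∑ ω, μ ω * A y ω i :=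
          fun y => Finset.sum_congr rfl (fun ω _ => by rw [hconst y ω j hj i hi])
        rwa [e, e] at h
  have h := key U (Finset.Subset.refl U)
  rwa [Finset.union_eq_right.mpr hVU] at h
end

section
/- There exist a constant c > 0 and n₀ such that the following holds for all n ≥ n₀ (n a perfect 20th power), with t = n^(1/5), r = n^(3/20), γ = n^(-1/10). Fix subsets V, S of [n] satisfying the requirements of admissibility (|S| = r³t, |V| = rt, V ⊆ S), and let T be drawn uniformly at random from all sets T ⊆ [n] making (V,S,T) admissible. Then for every fixed y ⊆ [n], the probability over T that all three conditions n_T(y) ≥ t, n_T(y) ≥ γ|y|, and n_T(y) ≥ n_S(y) hold (i.e. that algorithm A_{V,S,T,α} on input y returns x_T^α) is at most e^(−c·t/r) = e^(−c·n^(1/20)). -/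
/-!
Statement 2: fixing admissible `V ⊆ S`, for a uniformly random `T` making `(V,S,T)`
admissible and any fixed input `y`, the probability that the three conditions
`n_T(y) ≥ t`, `n_T(y) ≥ γ|y|`, `n_T(y) ≥ n_S(y)` all hold (i.e. that `A_{V,S,T,α}`
returns `x_T^α` on input `y`) is at most `e^{-c·t/r} = e^{-c·m}`, where
`n = m^20`, `t = m^4`, `r = m^3`, `γ = m^{-2}`.
-/

open Finset
open scoped Classical

lemma choose_aux (N k : ℕ) (hk : k ≤ N) (q : ℕ) (hq : q ≤ k) :
    (Nat.choose (N - q) (k - q)) * N ^ q ≤ Nat.choose N k * k ^ q := by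
  induction q with
  | zero => simp
  | succ q ih =>
    have ih := ih (by omega)
    obtain ⟨j, rfl⟩ : ∃ j, k = q + 1 + j := ⟨k - (q + 1), by omega⟩
    obtain ⟨d, rfl⟩ : ∃ d, N = q + 1 + j + d := ⟨N - (q + 1 + j), by omega⟩
    have e1 : q + 1 + j + d - (q + 1) = j + d := by omega
    have e2 : q + 1 + j - (q + 1) = j := by omega
    have e3 : q + 1 + j + d - q = j + d + 1 := by omega
    have e4 : q + 1 + j - q = j + 1 := by omega
    rw [e3, e4] at ih
    rw [e1, e2]
    have h := Nat.add_one_mul_choose_eq (j + d) j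
    -- N * (j+1) ≤ k * (j+d+1)
    have h2 : (q + 1 + j + d) * (j + 1) ≤ (q + 1 + j) * (j + d + 1) := by nlinarith [Nat.zero_le (q*d)]
    have hpos : 0 < j + d + 1 := by omega
    refine Nat.le_of_mul_le_mul_left ?_ hpos
    calc (j + d + 1) * ((j + d).choose j * (q + 1 + j + d) ^ (q + 1))
        = ((j + d + 1) * (j + d).choose j) * (q + 1 + j + d) ^ (q + 1) := by ring
      _ = ((j + d + 1).choose (j + 1) * (q + 1 + j + d) ^ q) * ((q + 1 + j + d) * (j + 1)) := by
          rw [h]; ring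
      _ ≤ ((q + 1 + j + d).choose (q + 1 + j) * (q + 1 + j) ^ q) * ((q + 1 + j) * (j + d + 1)) :=
          Nat.mul_le_mul ih h2
      _ = _ := by ring

lemma card_super {α : Type*} [DecidableEq α] (X Q : Finset α) (k : ℕ) (hQ : Q ⊆ X)
    (hk : k ≤ X.card) :
    ((Finset.powersetCard k X).filter (fun A => Q ⊆ A)).card * X.card ^ Q.card
      ≤ (Finset.powersetCard k X).card * k ^ Q.card := by
  by_cases hq : Q.card ≤ k
  · refine le_trans ?_ (le_trans (choose_aux X.card k hk Q.card hq) (by simp))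
    refine Nat.mul_le_mul_right _ ?_
    rw [← Finset.card_sdiff_of_subset hQ, ← Finset.card_powersetCard]
    refine Finset.card_le_card_of_injOn (fun A => A \ Q) ?_ ?_
    · intro A hA
      simp only [Finset.coe_filter, Finset.mem_powersetCard, Set.mem_ofPred_eq] at hA
      simp only [Finset.mem_coe, Finset.mem_powersetCard]
      refine ⟨Finset.sdiff_subset_sdiff hA.1.1 le_rfl, ?_⟩
      rw [Finset.card_sdiff_of_subset hA.2, hA.1.2]
    · intro A hA B hB hAB
      simp only [Finset.coe_filter, Finset.mem_powersetCard, Set.mem_ofPred_eq] at hA hB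
      simp only at hAB
      rw [← Finset.sdiff_union_of_subset hA.2, hAB, Finset.sdiff_union_of_subset hB.2]
  · have : (Finset.powersetCard k X).filter (fun A => Q ⊆ A) = ∅ := by
      ext A
      simp only [Finset.mem_filter, Finset.mem_powersetCard, Finset.notMem_empty, iff_false]
      rintro ⟨⟨_, h1⟩, h2⟩
      have := Finset.card_le_card h2
      omega
    simp [this]

lemma mgf {α : Type*} [DecidableEq α] (X y : Finset α) (k : ℕ) (hk : k ≤ X.card)
    (u p : ℝ) (hu : 0 ≤ u) (hX : 0 < X.card) (hp : (k : ℝ) ≤ p * X.card) :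
    ∑ A ∈ Finset.powersetCard k X, (u + 1) ^ (y ∩ A).card
      ≤ (Finset.powersetCard k X).card * Real.exp (u * p * (y ∩ X).card) := by
  have hXr : (0 : ℝ) < X.card := by exact_mod_cast hX
  have hp0 : 0 ≤ p := by
    by_contra h
    push Not at h
    have : (0 : ℝ) ≤ k := Nat.cast_nonneg k
    nlinarith
  have h1 : ∀ A ∈ Finset.powersetCard k X, (u + 1) ^ (y ∩ A).card
      = ∑ Q ∈ (y ∩ X).powerset, if Q ⊆ A then u ^ Q.card else 0 := by
    intro A hA
    rw [Finset.mem_powersetCard] at hA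
    rw [← Finset.sum_pow_mul_eq_add_pow, ← Finset.sum_filter]
    simp only [one_pow, mul_one]
    refine Finset.sum_congr ?_ (fun _ _ => rfl)
    ext Q
    simp only [Finset.mem_powerset, Finset.mem_filter, Finset.subset_inter_iff]
    constructor
    · rintro ⟨a, b⟩
      exact ⟨⟨a, b.trans hA.1⟩, b⟩
    · rintro ⟨⟨a, _⟩, b⟩
      exact ⟨a, b⟩
  rw [Finset.sum_congr rfl h1, Finset.sum_comm]
  have h2 : ∀ Q ∈ (y ∩ X).powerset,
      (∑ A ∈ Finset.powersetCard k X, if Q ⊆ A then u ^ Q.card else 0)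
        ≤ (Finset.powersetCard k X).card * (u * p) ^ Q.card := by
    intro Q hQ
    rw [Finset.mem_powerset, Finset.subset_inter_iff] at hQ
    rw [← Finset.sum_filter, Finset.sum_const, nsmul_eq_mul]
    have h3 := card_super X Q k hQ.2 hk
    have h3' : (((Finset.powersetCard k X).filter (fun A => Q ⊆ A)).card : ℝ) * X.card ^ Q.card
      ≤ (Finset.powersetCard k X).card * (k : ℝ) ^ Q.card := by exact_mod_cast h3
    have h4 : (k : ℝ) ^ Q.card ≤ (p * X.card) ^ Q.card :=
      pow_le_pow_left₀ (Nat.cast_nonneg k) hp _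
    have h5 : (((Finset.powersetCard k X).filter (fun A => Q ⊆ A)).card : ℝ)
        ≤ (Finset.powersetCard k X).card * p ^ Q.card := by
      refine le_of_mul_le_mul_right ?_ (pow_pos hXr Q.card)
      refine h3'.trans ?_
      rw [mul_assoc, ← mul_pow]
      exact mul_le_mul_of_nonneg_left h4 (Nat.cast_nonneg _)
    calc _ ≤ ((Finset.powersetCard k X).card * p ^ Q.card) * u ^ Q.card :=
          mul_le_mul_of_nonneg_right h5 (pow_nonneg hu _)
      _ = _ := by rw [mul_pow]; ring
  refine (Finset.sum_le_sum h2).trans ?_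
  rw [← Finset.mul_sum]
  refine mul_le_mul_of_nonneg_left ?_ (Nat.cast_nonneg _)
  have h6 := Finset.sum_pow_mul_eq_add_pow (u * p) 1 (y ∩ X)
  simp only [one_pow, mul_one] at h6
  rw [h6, mul_comm (u * p) ((y ∩ X).card : ℝ), Real.exp_nat_mul]
  exact pow_le_pow_left₀ (by positivity) (Real.add_one_le_exp _) _

lemma sum_adm {α : Type*} [Fintype α] [DecidableEq α] (V S : Finset α) (hVS : V ⊆ S)
    (k l d e : ℕ) (hk : V.card + k = d) (hl : d + l = e) (P : Finset α → Prop) [DecidablePred P]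
    (hP : ∀ T, P T ↔ (T.card = e ∧ (S ∩ T).card = d ∧ V ⊆ S ∩ T))
    (f : Finset α → ℝ) :
    ∑ T ∈ Finset.univ.filter P, f T
      = ∑ A ∈ Finset.powersetCard k (S \ V), ∑ B ∈ Finset.powersetCard l Sᶜ, f (V ∪ A ∪ B) := by
  rw [← Finset.sum_product']
  symm
  refine Finset.sum_nbij' (fun x => V ∪ x.1 ∪ x.2) (fun T => ((S ∩ T) \ V, T \ S)) ?_ ?_ ?_ ?_ ?_
  · rintro ⟨A, B⟩ h
    simp only [Finset.mem_product, Finset.mem_powersetCard] at h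
    obtain ⟨⟨hA, hA'⟩, hB, hB'⟩ := h
    simp only [Finset.mem_filter, Finset.mem_univ, true_and, hP]
    have hVA : Disjoint V A :=
      (Finset.disjoint_sdiff (s := V) (t := S)).mono_right hA
    have hAS : A ⊆ S := hA.trans Finset.sdiff_subset
    have hSB : Disjoint (V ∪ A) B :=
      (disjoint_compl_right (a := S)).mono (Finset.union_subset hVS hAS) hB
    have hS : S ∩ (V ∪ A ∪ B) = V ∪ A := by
      ext x
      have := @hVS x
      have := @hAS x
      have := @hB x
      simp only [Finset.mem_compl] at this
      simp only [Finset.mem_inter, Finset.mem_union]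
      tauto
    rw [hS, Finset.card_union_of_disjoint hSB, Finset.card_union_of_disjoint hVA]
    exact ⟨by omega, by omega, Finset.subset_union_left⟩
  · intro T h
    simp only [Finset.mem_filter, Finset.mem_univ, true_and, hP] at h
    obtain ⟨h1, h2, h3⟩ := h
    simp only [Finset.mem_product, Finset.mem_powersetCard]
    refine ⟨⟨Finset.sdiff_subset_sdiff Finset.inter_subset_left le_rfl, ?_⟩, ?_, ?_⟩
    · rw [Finset.card_sdiff_of_subset h3]; omega
    · intro x hx
      simp only [Finset.mem_sdiff, Finset.mem_compl] at hx ⊢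
      exact hx.2
    · have := Finset.card_sdiff_add_card_inter T S
      rw [Finset.inter_comm] at this
      omega
  · rintro ⟨A, B⟩ h
    simp only [Finset.mem_product, Finset.mem_powersetCard] at h
    obtain ⟨⟨hA, hA'⟩, hB, hB'⟩ := h
    simp only [Prod.mk.injEq]
    constructor
    · ext x
      have := @hVS x
      have := @hA x
      have := @hB x
      simp only [Finset.mem_compl, Finset.mem_sdiff] at *
      simp only [Finset.mem_inter, Finset.mem_union]
      tauto
    · ext x
      have := @hVS x
      have := @hA x
      have := @hB x
      simp only [Finset.mem_compl, Finset.mem_sdiff] at *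
      simp only [Finset.mem_union]
      tauto
  · intro T h
    simp only [Finset.mem_filter, Finset.mem_univ, true_and, hP] at h
    obtain ⟨h1, h2, h3⟩ := h
    ext x
    have := @h3 x
    simp only [Finset.mem_inter, Finset.mem_sdiff, Finset.mem_union] at *
    tauto
  · intro x _
    rfl

lemma main_bound {α : Type*} [Fintype α] [DecidableEq α] (V S y : Finset α) (hVS : V ⊆ S)
    (k l d e : ℕ) (hk : V.card + k = d) (hl : d + l = e) (P : Finset α → Prop) [DecidablePred P]
    (hP : ∀ T, P T ↔ (T.card = e ∧ (S ∩ T).card = d ∧ V ⊆ S ∩ T))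
    (p q : ℝ) (hk' : k ≤ (S \ V).card) (hl' : l ≤ Sᶜ.card)
    (h0 : 0 < (S \ V).card) (h0' : 0 < Sᶜ.card)
    (hp : (k : ℝ) ≤ p * (S \ V).card) (hq : (l : ℝ) ≤ q * Sᶜ.card) :
    ∑ T ∈ Finset.univ.filter P, (4 : ℝ) ^ (y ∩ ((S ∩ T) \ V)).card * 2 ^ (y ∩ (T \ S)).card
      ≤ (Finset.univ.filter P).card *
        Real.exp (3 * p * (y ∩ (S \ V)).card + q * (y ∩ Sᶜ).card) := by
  have hc := sum_adm V S hVS k l d e hk hl P hP (fun _ => 1)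
  simp only [Finset.sum_const, nsmul_eq_mul, mul_one] at hc
  rw [hc, sum_adm V S hVS k l d e hk hl P hP]
  have h1 : ∀ A ∈ Finset.powersetCard k (S \ V), ∀ B ∈ Finset.powersetCard l Sᶜ,
      (4 : ℝ) ^ (y ∩ ((S ∩ (V ∪ A ∪ B)) \ V)).card * 2 ^ (y ∩ ((V ∪ A ∪ B) \ S)).card
       = (3 + 1 : ℝ) ^ (y ∩ A).card * (1 + 1) ^ (y ∩ B).card := by
    intro A hA B hB
    simp only [Finset.mem_powersetCard] at hA hB
    have e1 : (S ∩ (V ∪ A ∪ B)) \ V = A := by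
      ext x
      have := @hVS x
      have := @hA.1 x
      have := @hB.1 x
      simp only [Finset.mem_compl, Finset.mem_sdiff] at *
      simp only [Finset.mem_inter, Finset.mem_union]
      tauto
    have e2 : (V ∪ A ∪ B) \ S = B := by
      ext x
      have := @hVS x
      have := @hA.1 x
      have := @hB.1 x
      simp only [Finset.mem_compl, Finset.mem_sdiff] at *
      simp only [Finset.mem_union]
      tauto
    rw [e1, e2]; norm_num
  rw [Finset.sum_congr rfl (fun A hA => Finset.sum_congr rfl (h1 A hA)), ← Finset.sum_mul_sum,
    Real.exp_add]
  have m1 := mgf (S \ V) y k hk' 3 p (by norm_num) h0 hp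
  have m2 := mgf Sᶜ y l hl' 1 q (by norm_num) h0' hq
  rw [one_mul] at m2
  calc _ ≤ _ := mul_le_mul m1 m2 (Finset.sum_nonneg fun _ _ => by positivity) (by positivity)
    _ = _ := by ring

set_option maxHeartbeats 1000000 in
lemma final_bound {α : Type*} [Fintype α] [DecidableEq α] (m : ℕ) (hm : 10 ≤ m)
    (V S y : Finset α) (hVS : V ⊆ S) (hn : Fintype.card α = m ^ 20)
    (hS : S.card = m ^ 13) (hV : V.card = m ^ 7)
    (P R : Finset α → Prop) [DecidablePred P] [DecidablePred R]
    (hP : ∀ T, P T ↔ (T.card = m ^ 13 ∧ (S ∩ T).card = m ^ 10 ∧ V ⊆ S ∩ T))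
    (hR : ∀ T, R T → P T ∧ m ^ 4 ≤ (y ∩ T).card + (y ∩ (S ∩ T)).card ∧
      ((m : ℝ) ^ 2)⁻¹ * y.card ≤ ((y ∩ T).card + (y ∩ (S ∩ T)).card : ℕ) ∧
      (y ∩ S).card + 2 * (y ∩ V).card ≤ (y ∩ T).card + (y ∩ (S ∩ T)).card) :
    ((Finset.univ.filter R).card : ℝ) / ((Finset.univ.filter P).card : ℝ) ≤ Real.exp (-m) := by
  have hmr : (10 : ℝ) ≤ m := by exact_mod_cast hm
  have hm0 : (0 : ℝ) < m := by linarith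
  have m1 : 1 ≤ m := by omega
  have a1 : m ^ 7 < m ^ 10 := Nat.pow_lt_pow_right (by omega) (by norm_num)
  have a2 : m ^ 10 < m ^ 13 := Nat.pow_lt_pow_right (by omega) (by norm_num)
  have a3 : m ^ 13 < m ^ 20 := Nat.pow_lt_pow_right (by omega) (by norm_num)
  have cSV : (S \ V).card = m ^ 13 - m ^ 7 := by rw [Finset.card_sdiff_of_subset hVS, hS, hV]
  have cSc : Sᶜ.card = m ^ 20 - m ^ 13 := by rw [Finset.card_compl, hS, hn]
  have b1 : (m : ℝ) ^ 4 ≤ m ^ 7 := pow_le_pow_right₀ (by linarith) (by norm_num)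
  have b2 : (m : ℝ) ^ 6 ≤ m ^ 10 := pow_le_pow_right₀ (by linarith) (by norm_num)
  have a4 : m ^ 13 - m ^ 10 ≤ m ^ 20 - m ^ 13 := by
    have : 2 * m ^ 13 ≤ m ^ 20 := by
      calc 2 * m ^ 13 ≤ m * m ^ 13 := Nat.mul_le_mul_right _ (by omega)
        _ = m ^ 14 := by ring
        _ ≤ m ^ 20 := Nat.pow_le_pow_right m1 (by norm_num)
    omega
  have main := main_bound V S y hVS (m ^ 10 - m ^ 7) (m ^ 13 - m ^ 10) (m ^ 10) (m ^ 13)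
    (by rw [hV]; omega) (by omega) P hP (((m : ℝ) ^ 3)⁻¹) (((m : ℝ) ^ 7)⁻¹)
    (by rw [cSV]; omega) (by rw [cSc]; omega) (by rw [cSV]; omega) (by rw [cSc]; omega)
    (by
      rw [cSV, Nat.cast_sub a1.le, Nat.cast_sub (a1.trans a2).le, inv_mul_eq_div,
        le_div_iff₀ (by positivity)]
      push_cast
      have : (m : ℝ) ^ 7 ≤ m ^ 10 := pow_le_pow_right₀ (by linarith) (by norm_num)
      have e : ((m : ℝ) ^ 10 - m ^ 7) * m ^ 3 = m ^ 13 - m ^ 10 := by ring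
      linarith)
    (by
      rw [cSc, Nat.cast_sub a2.le, Nat.cast_sub a3.le, inv_mul_eq_div,
        le_div_iff₀ (by positivity)]
      push_cast
      have : (m : ℝ) ^ 13 ≤ m ^ 17 := pow_le_pow_right₀ (by linarith) (by norm_num)
      have e : ((m : ℝ) ^ 13 - m ^ 10) * m ^ 7 = m ^ 20 - m ^ 17 := by ring
      linarith)
  set K : ℝ := 3 * ((m : ℝ) ^ 3)⁻¹ * (y ∩ (S \ V)).card + ((m : ℝ) ^ 7)⁻¹ * (y ∩ Sᶜ).card with hK
  have key : ∀ T ∈ Finset.univ.filter R, Real.exp (K + m) ≤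
      (4 : ℝ) ^ (y ∩ ((S ∩ T) \ V)).card * 2 ^ (y ∩ (T \ S)).card := by
    intro T hT
    simp only [Finset.mem_filter, Finset.mem_univ, true_and] at hT
    obtain ⟨hPT, r1, r2, r3⟩ := hR T hT
    obtain ⟨-, -, p3⟩ := (hP T).1 hPT
    set a := (y ∩ ((S ∩ T) \ V)).card with ha
    set b := (y ∩ (T \ S)).card with hb
    have c1 : (y ∩ (S ∩ T)).card = a + (y ∩ V).card := by
      rw [ha, ← Finset.card_union_of_disjoint]
      · congr 1
        ext x
        have := @p3 x
        simp only [Finset.mem_inter, Finset.mem_sdiff, Finset.mem_union] at *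
        tauto
      · rw [Finset.disjoint_left]
        intro x
        simp only [Finset.mem_inter, Finset.mem_sdiff]
        tauto
    have c2 : (y ∩ T).card = b + (y ∩ (S ∩ T)).card := by
      rw [hb, ← Finset.card_union_of_disjoint]
      · congr 1
        ext x
        simp only [Finset.mem_inter, Finset.mem_sdiff, Finset.mem_union] at *
        tauto
      · rw [Finset.disjoint_left]
        intro x
        simp only [Finset.mem_inter, Finset.mem_sdiff]
        tauto
    have c3 : (y ∩ V).card ≤ (y ∩ S).card :=
      Finset.card_le_card (Finset.inter_subset_inter_left hVS)
    have c4 : (y ∩ (S \ V)).card ≤ (y ∩ S).card :=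
      Finset.card_le_card (Finset.inter_subset_inter_left Finset.sdiff_subset)
    have c5 : (y ∩ Sᶜ).card ≤ y.card := Finset.card_le_card Finset.inter_subset_left
    have d1 : (y ∩ (S \ V)).card ≤ 2 * a + b := by omega
    have d2 : m ^ 4 ≤ 3 * (2 * a + b) := by omega
    have d3 : (y ∩ T).card + (y ∩ (S ∩ T)).card ≤ 3 * (2 * a + b) := by omega
    generalize hW : 2 * a + b = W at *
    have e0 : (4 : ℝ) ^ a * 2 ^ b = 2 ^ W := by
      rw [← hW, pow_add, pow_mul]; norm_num
    rw [e0]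
    have f1 : ((y ∩ (S \ V)).card : ℝ) ≤ W := by exact_mod_cast d1
    have f2 : (m : ℝ) ^ 4 ≤ 3 * W := by exact_mod_cast d2
    have f3 : ((m : ℝ) ^ 2)⁻¹ * y.card ≤ 3 * W := r2.trans (by exact_mod_cast d3)
    have f5 : ((y ∩ Sᶜ).card : ℝ) ≤ y.card := by exact_mod_cast c5
    have g1 : ((m : ℝ) ^ 3)⁻¹ ≤ 1 / 100 := by
      rw [inv_le_comm₀ (by positivity) (by norm_num)]; norm_num
      have h3 : (10 : ℝ) ^ 3 ≤ (m : ℝ) ^ 3 := pow_le_pow_left₀ (by norm_num) hmr 3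
      linarith
    have g2 : ((m : ℝ) ^ 5)⁻¹ ≤ 1 / 100 := by
      rw [inv_le_comm₀ (by positivity) (by norm_num)]; norm_num
      have h3 : (10 : ℝ) ^ 5 ≤ (m : ℝ) ^ 5 := pow_le_pow_left₀ (by norm_num) hmr 5
      linarith
    have hW0 : (0 : ℝ) ≤ W := Nat.cast_nonneg W
    have t1 : 3 * ((m : ℝ) ^ 3)⁻¹ * (y ∩ (S \ V)).card ≤ 3 * (1 / 100) * W := by
      gcongr
    have t2 : ((m : ℝ) ^ 7)⁻¹ * (y ∩ Sᶜ).card ≤ 1 / 100 * (3 * W) := by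
      calc ((m : ℝ) ^ 7)⁻¹ * (y ∩ Sᶜ).card ≤ ((m : ℝ) ^ 7)⁻¹ * y.card := by gcongr
        _ = ((m : ℝ) ^ 5)⁻¹ * (((m : ℝ) ^ 2)⁻¹ * y.card) := by
          rw [← mul_assoc, ← mul_inv, ← pow_add]
        _ ≤ 1 / 100 * (3 * W) := by gcongr
    have t3 : (m : ℝ) ≤ W / 10 := by
      have h3 : (10 : ℝ) ^ 3 ≤ (m : ℝ) ^ 3 := pow_le_pow_left₀ (by norm_num) hmr 3
      have h4 := mul_le_mul_of_nonneg_right h3 hm0.le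
      have e : (m : ℝ) ^ 3 * m = m ^ 4 := by ring
      linarith
    have hh : Real.exp (1 / 2) ≤ 2 := by
      have : Real.exp (1 / 2) ^ 2 = Real.exp 1 := by
        rw [← Real.exp_nat_mul]; norm_num
      nlinarith [Real.exp_one_lt_d9, Real.exp_pos (1 / 2)]
    calc Real.exp (K + m) ≤ Real.exp (W * (1 / 2)) := by
          apply Real.exp_le_exp.2
          rw [hK]; linarith
      _ = Real.exp (1 / 2) ^ W := Real.exp_nat_mul _ _
      _ ≤ 2 ^ W := pow_le_pow_left₀ (Real.exp_pos _).le hh _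
  have s1 : ((Finset.univ.filter R).card : ℝ) * Real.exp (K + m)
      ≤ (Finset.univ.filter P).card * Real.exp K := by
    refine le_trans ?_ main
    rw [← nsmul_eq_mul, ← Finset.sum_const]
    refine (Finset.sum_le_sum key).trans ?_
    refine Finset.sum_le_sum_of_subset_of_nonneg ?_ (fun _ _ _ => by positivity)
    intro T hT
    simp only [Finset.mem_filter, Finset.mem_univ, true_and] at hT ⊢
    exact (hR T hT).1
  refine div_le_of_le_mul₀ (Nat.cast_nonneg _) (Real.exp_pos _).le ?_
  refine le_of_mul_le_mul_right ?_ (Real.exp_pos (K + m))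
  refine s1.trans (le_of_eq ?_)
  rw [mul_comm (Real.exp (-m)), mul_assoc, ← Real.exp_add]
  congr 2
  ring

theorem stmt2 :
    ∃ c : ℝ, 0 < c ∧ ∃ n₀ : ℕ, ∀ m : ℕ, n₀ ≤ m →
      ∀ V S : Finset (Fin (m ^ 20)), V ⊆ S → S.card = m ^ 13 → V.card = m ^ 7 →
        ∀ y : Finset (Fin (m ^ 20)),
          (((Finset.univ.filter (fun T : Finset (Fin (m ^ 20)) =>
                (T.card = m ^ 13 ∧ (S ∩ T).card = m ^ 10 ∧ V ⊆ S ∩ T) ∧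
                (m ^ 4 ≤ nTcount S T y ∧
                  ((m : ℝ) ^ 2)⁻¹ * y.card ≤ (nTcount S T y : ℝ) ∧
                  nScount S V y ≤ nTcount S T y))).card : ℝ) /
              ((Finset.univ.filter (fun T : Finset (Fin (m ^ 20)) =>
                T.card = m ^ 13 ∧ (S ∩ T).card = m ^ 10 ∧ V ⊆ S ∩ T)).card : ℝ))
            ≤ Real.exp (-(c * m)) := by
  refine ⟨1, one_pos, 10, ?_⟩
  intro m hm V S hVS hS hV y
  rw [one_mul]
  refine final_bound m hm V S y hVS (by simp) hS hV _ _ (fun T => Iff.rfl) ?_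
  intro T hT
  exact hT
end

section
/- There exist a constant c > 0 and n₀ such that the following holds for all n ≥ n₀ (n a perfect 20th power), with t = n^(1/5), r = n^(3/20), γ = n^(-1/10). Fix subsets U, T of [n] satisfying the requirements of admissibility (|T| = r³t, |U| = r²t, U ⊆ T), and let the pair (V,S) be drawn uniformly at random from all pairs making (V,S,T) admissible with S∩T = U (i.e., V a uniformly random subset of U with |V| = rt, and S ⊇ U with |S| = r³t and S∩T = U). Then for every fixed y ⊆ [n], the probability over (V,S) that all three conditions n_S(y) ≥ t, n_S(y) ≥ γ|y|, and n_S(y) ≥ n_T(y) hold (i.e. that algorithm A_{V,S,T,α} on input y returns x_S^1) is at most e^(−c·t/r) = e^(−c·n^(1/20)). -/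
/-!
Statement 3: fixing admissible `U ⊆ T`, for a uniformly random pair `(V,S)` making
`(V,S,T)` admissible with `S ∩ T = U`, and any fixed input `y`, the probability that
the three conditions `n_S(y) ≥ t`, `n_S(y) ≥ γ|y|`, `n_S(y) ≥ n_T(y)` all hold
(i.e. that `A_{V,S,T,α}` returns `x_S^1` on input `y`) is at most
`e^{-c·t/r} = e^{-c·m}`, where `n = m^20`, `t = m^4`, `r = m^3`, `γ = m^{-2}`.
-/

open Finset
open scoped Classical

lemma choose_ratio_aux (j : ℕ) : ∀ N k : ℕ, k ≤ N → j ≤ k →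
    ((N - j).choose (k - j) : ℝ) ≤ (N.choose k : ℝ) * ((k : ℝ) / N) ^ j := by
  induction j with
  | zero => intro N k _ _; simp
  | succ j ih =>
    intro N k hkN hjk
    obtain ⟨N, rfl⟩ : ∃ N', N = N' + 1 := ⟨N - 1, by omega⟩
    obtain ⟨k, rfl⟩ : ∃ k', k = k' + 1 := ⟨k - 1, by omega⟩
    have h := ih N k (by omega) (by omega)
    rw [Nat.add_sub_add_right, Nat.add_sub_add_right]
    have hc : (N.choose k : ℝ) = ((N + 1).choose (k + 1) : ℝ) * (((k + 1 : ℕ) : ℝ) / ((N + 1 : ℕ) : ℝ)) := by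
      have h1 : (((N + 1) * N.choose k : ℕ) : ℝ) = (((N + 1).choose (k + 1) * (k + 1) : ℕ) : ℝ) := by
        exact_mod_cast Nat.add_one_mul_choose_eq N k
      have h2 : ((N + 1 : ℕ) : ℝ) ≠ 0 := by positivity
      push_cast at h1 h2 ⊢
      field_simp
      linarith
    have hr : (k : ℝ) / N ≤ ((k + 1 : ℕ) : ℝ) / ((N + 1 : ℕ) : ℝ) := by
      have hk : (k : ℝ) ≤ N := by exact_mod_cast (by omega : k ≤ N)
      rcases Nat.eq_zero_or_pos N with h0 | h0
      · subst h0; simp; positivity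
      · have h0' : (0 : ℝ) < N := by exact_mod_cast h0
        rw [div_le_div_iff₀ h0' (by positivity)]
        push_cast
        nlinarith
    calc ((N - j).choose (k - j) : ℝ) ≤ (N.choose k : ℝ) * ((k : ℝ) / N) ^ j := h
      _ ≤ (N.choose k : ℝ) * (((k + 1 : ℕ) : ℝ) / ((N + 1 : ℕ) : ℝ)) ^ j := by gcongr
      _ = _ := by rw [hc, pow_succ]; ring

lemma count_sup_aux {α : Type*} [DecidableEq α] (A R : Finset α) (hR : R ⊆ A) (k : ℕ) (hk : k ≤ A.card) :
    (((A.powersetCard k).filter (fun S => R ⊆ S)).card : ℝ)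
      ≤ (A.card.choose k : ℝ) * ((k : ℝ) / A.card) ^ R.card := by
  by_cases hj : R.card ≤ k
  · refine le_trans ?_ (choose_ratio_aux R.card A.card k hk hj)
    have : ((A.powersetCard k).filter (fun S => R ⊆ S)).card
        ≤ ((A \ R).powersetCard (k - R.card)).card := by
      apply Finset.card_le_card_of_injOn (fun S => S \ R)
      · intro S hS
        simp only [Finset.coe_filter, Finset.mem_powersetCard, Set.mem_ofPred_eq] at hS
        simp only [Finset.mem_coe, Finset.mem_powersetCard]
        exact ⟨Finset.sdiff_subset_sdiff hS.1.1 (le_refl _), by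
          rw [Finset.card_sdiff_of_subset hS.2, hS.1.2]⟩
      · intro S hS S' hS' h
        simp only [Finset.coe_filter, Finset.mem_powersetCard, Set.mem_ofPred_eq] at hS hS'
        have h' : S \ R = S' \ R := h
        rw [← Finset.sdiff_union_of_subset hS.2, h', Finset.sdiff_union_of_subset hS'.2]
    rw [Finset.card_powersetCard, Finset.card_sdiff_of_subset hR] at this
    exact_mod_cast this
  · have : (A.powersetCard k).filter (fun S => R ⊆ S) = ∅ := by
      apply Finset.filter_eq_empty_iff.2
      intro S hS h
      have := Finset.card_le_card h
      rw [(Finset.mem_powersetCard.1 hS).2] at this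
      exact hj this
    rw [this]
    simp only [Finset.card_empty, Nat.cast_zero]
    positivity

lemma hyp_mgf_aux {α : Type*} [DecidableEq α] (A y : Finset α) (k : ℕ) (hk : k ≤ A.card) (l : ℝ) (hl : 0 ≤ l) :
    ∑ S ∈ A.powersetCard k, (l + 1) ^ (y ∩ S).card
      ≤ ((A.powersetCard k).card : ℝ) * Real.exp (l * ((k : ℝ) / A.card) * (y ∩ A).card) := by
  have e1 : ∀ S ∈ A.powersetCard k, (l + 1) ^ (y ∩ S).card
      = ∑ R ∈ (y ∩ A).powerset, if R ⊆ S then l ^ R.card else 0 := by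
    intro S hS
    have hSA := (Finset.mem_powersetCard.1 hS).1
    rw [← Finset.sum_pow_mul_eq_add_pow l 1 (y ∩ S), ← Finset.sum_filter]
    simp only [one_pow, mul_one]
    apply Finset.sum_congr _ (fun _ _ => rfl)
    ext R
    simp only [Finset.mem_powerset, Finset.mem_filter, Finset.subset_inter_iff]
    constructor
    · rintro ⟨h1, h2⟩; exact ⟨⟨h1, h2.trans hSA⟩, h2⟩
    · rintro ⟨⟨h1, _⟩, h2⟩; exact ⟨h1, h2⟩
  rw [Finset.sum_congr rfl e1, Finset.sum_comm, Finset.card_powersetCard]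
  have e2 : ∀ R ∈ (y ∩ A).powerset, (∑ S ∈ A.powersetCard k, if R ⊆ S then l ^ R.card else 0)
      ≤ (A.card.choose k : ℝ) * ((l * ((k : ℝ) / A.card)) ^ R.card * 1 ^ ((y ∩ A).card - R.card)) := by
    intro R hR
    have hRA := (Finset.mem_powerset.1 hR).trans Finset.inter_subset_right
    rw [← Finset.sum_filter, Finset.sum_const, nsmul_eq_mul, one_pow, mul_one, mul_pow]
    have := mul_le_mul_of_nonneg_right (count_sup_aux A R hRA k hk) (pow_nonneg hl R.card)
    linarith
  refine (Finset.sum_le_sum e2).trans ?_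
  rw [← Finset.mul_sum, Finset.sum_pow_mul_eq_add_pow]
  apply mul_le_mul_of_nonneg_left _ (by positivity)
  have := Real.add_one_le_exp (l * ((k : ℝ) / A.card))
  calc _ ≤ Real.exp (l * ((k : ℝ) / A.card)) ^ (y ∩ A).card := by
        apply pow_le_pow_left₀ (by positivity) this
    _ = _ := by rw [← Real.exp_nat_mul]; ring_nf

lemma key_arith_aux (m a b d L q : ℝ) (hm : 10 ≤ m) (ha : 0 ≤ a) (hb : 0 ≤ b) (hd : 0 ≤ d)
    (h1 : m ^ 4 ≤ a + L) (h2 : (m ^ 2)⁻¹ * (a + b + d) ≤ a + L) (h3 : a + b ≤ L)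
    (hq : q ≤ 2 / m ^ 7) :
    m + (1 * q * d + 3 * (m ^ 7 / m ^ 10) * a) ≤ L * Real.log 2 := by
  have hm0 : 0 < m := by linarith
  have hL0 : 0 ≤ L := by linarith
  have hlog := Real.log_two_gt_d9
  have h4 : L * 0.69 ≤ L * Real.log 2 := mul_le_mul_of_nonneg_left (by linarith) hL0
  have h5 : m ^ 7 / m ^ 10 = 1 / m ^ 3 := by field_simp
  have h6 : 1 / m ^ 3 ≤ 1 / 1000 := by
    apply one_div_le_one_div_of_le (by norm_num)
    calc (1000 : ℝ) = 10 ^ 3 := by norm_num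
      _ ≤ m ^ 3 := by gcongr
  have h7 : d ≤ m ^ 2 * (2 * L) := by
    rw [inv_mul_le_iff₀ (by positivity)] at h2
    have : m ^ 2 * (a + L) ≤ m ^ 2 * (2 * L) := by gcongr; linarith
    linarith
  have h8 : q * d ≤ L / 1000 := by
    calc q * d ≤ 2 / m ^ 7 * d := by gcongr
      _ ≤ 2 / m ^ 7 * (m ^ 2 * (2 * L)) := by gcongr
      _ = 4 * L * (1 / m ^ 5) := by field_simp; ring
      _ ≤ 4 * L * (1 / 10 ^ 5) := by gcongr
      _ ≤ L / 1000 := by linarith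
  have h9 : 1 / m ^ 3 * a ≤ 1 / 1000 * L := by
    apply mul_le_mul h6 (by linarith) ha (by norm_num)
  have h10 : 1000 * m ≤ m ^ 4 := by
    have : (10 : ℝ) ^ 3 ≤ m ^ 3 := by gcongr
    nlinarith
  rw [h5]
  linarith

theorem stmt3 :
    ∃ c : ℝ, 0 < c ∧ ∃ n₀ : ℕ, ∀ m : ℕ, n₀ ≤ m →
      ∀ U T : Finset (Fin (m ^ 20)), U ⊆ T → T.card = m ^ 13 → U.card = m ^ 10 →
        ∀ y : Finset (Fin (m ^ 20)),
          (((Finset.univ.filter (fun p : Finset (Fin (m ^ 20)) × Finset (Fin (m ^ 20)) =>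
                (p.1 ⊆ U ∧ p.1.card = m ^ 7 ∧ U ⊆ p.2 ∧ p.2.card = m ^ 13 ∧
                  p.2 ∩ T = U) ∧
                (m ^ 4 ≤ nScount p.2 p.1 y ∧
                  ((m : ℝ) ^ 2)⁻¹ * y.card ≤ (nScount p.2 p.1 y : ℝ) ∧
                  nTcount p.2 T y ≤ nScount p.2 p.1 y))).card : ℝ) /
              ((Finset.univ.filter (fun p : Finset (Fin (m ^ 20)) × Finset (Fin (m ^ 20)) =>
                p.1 ⊆ U ∧ p.1.card = m ^ 7 ∧ U ⊆ p.2 ∧ p.2.card = m ^ 13 ∧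
                  p.2 ∩ T = U)).card : ℝ))
            ≤ Real.exp (-(c * m)) := by
  refine ⟨1, one_pos, 10, ?_⟩
  intro m hm U T hUT hT hU y
  set all := (Finset.univ.filter (fun p : Finset (Fin (m ^ 20)) × Finset (Fin (m ^ 20)) =>
                p.1 ⊆ U ∧ p.1.card = m ^ 7 ∧ U ⊆ p.2 ∧ p.2.card = m ^ 13 ∧
                  p.2 ∩ T = U)) with hall
  set bad := (Finset.univ.filter (fun p : Finset (Fin (m ^ 20)) × Finset (Fin (m ^ 20)) =>
                (p.1 ⊆ U ∧ p.1.card = m ^ 7 ∧ U ⊆ p.2 ∧ p.2.card = m ^ 13 ∧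
                  p.2 ∩ T = U) ∧
                (m ^ 4 ≤ nScount p.2 p.1 y ∧
                  ((m : ℝ) ^ 2)⁻¹ * y.card ≤ (nScount p.2 p.1 y : ℝ) ∧
                  nTcount p.2 T y ≤ nScount p.2 p.1 y))) with hbad
  have hm1 : 1 ≤ m := by omega
  have hmR : (10 : ℝ) ≤ m := by exact_mod_cast hm
  have hm0 : (0 : ℝ) < m := by linarith
  set A := (Finset.univ \ T : Finset (Fin (m ^ 20))) with hA
  set k := m ^ 13 - m ^ 10 with hk
  have h1013 : m ^ 10 ≤ m ^ 13 := Nat.pow_le_pow_right hm1 (by norm_num)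
  have h1320 : 2 * m ^ 13 ≤ m ^ 20 := by
    calc 2 * m ^ 13 ≤ m ^ 7 * m ^ 13 := by
          apply Nat.mul_le_mul_right
          calc 2 ≤ m := by omega
            _ = m ^ 1 := (pow_one m).symm
            _ ≤ m ^ 7 := Nat.pow_le_pow_right hm1 (by norm_num)
      _ = m ^ 20 := by ring
  have hAc : A.card = m ^ 20 - m ^ 13 := by
    rw [hA, Finset.card_sdiff_of_subset (Finset.subset_univ _), hT, Finset.card_univ, Fintype.card_fin]
  have hkA : k ≤ A.card := by omega
  have h7U : m ^ 7 ≤ U.card := by rw [hU]; exact Nat.pow_le_pow_right hm1 (by norm_num)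
  have hdisj : ∀ S ∈ A.powersetCard k, Disjoint S T := by
    intro S hS
    have h0 : Disjoint A T := Finset.sdiff_disjoint
    exact h0.mono_left (Finset.mem_powersetCard.1 hS).1
  -- reindexing
  have hreidx : ∀ f : Finset (Fin (m ^ 20)) × Finset (Fin (m ^ 20)) → ℝ,
      ∑ p ∈ all, f (p.1, p.2 \ U) = ∑ q ∈ U.powersetCard (m ^ 7) ×ˢ A.powersetCard k, f q := by
    intro f
    refine Finset.sum_nbij' (fun p => (p.1, p.2 \ U)) (fun q => (q.1, q.2 ∪ U)) ?_ ?_ ?_ ?_ ?_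
    · rintro ⟨V, S⟩ hp
      simp only [hall, Finset.mem_filter, Finset.mem_univ, true_and] at hp
      obtain ⟨h1, h2, h3, h4, h5⟩ := hp
      simp only [Finset.mem_product, Finset.mem_powersetCard]
      refine ⟨⟨h1, h2⟩, ?_, ?_⟩
      · intro x hx
        rw [Finset.mem_sdiff] at hx
        rw [hA, Finset.mem_sdiff]
        refine ⟨Finset.mem_univ _, fun hxT => hx.2 ?_⟩
        rw [← h5]; exact Finset.mem_inter.2 ⟨hx.1, hxT⟩
      · rw [Finset.card_sdiff_of_subset h3, h4, hU]
    · rintro ⟨V, S⟩ hq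
      have hq' := Finset.mem_product.1 hq
      have hd := hdisj S hq'.2
      simp only [Finset.mem_product, Finset.mem_powersetCard] at hq
      obtain ⟨⟨h1, h2⟩, h3, h4⟩ := hq
      simp only [hall, Finset.mem_filter, Finset.mem_univ, true_and]
      refine ⟨h1, h2, Finset.subset_union_right, ?_, ?_⟩
      · rw [Finset.card_union_of_disjoint (hd.mono_right hUT), h4, hU]; omega
      · rw [Finset.union_inter_distrib_right, Finset.disjoint_iff_inter_eq_empty.1 hd,
          Finset.empty_union, Finset.inter_eq_left.2 hUT]
    · rintro ⟨V, S⟩ hp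
      simp only [hall, Finset.mem_filter, Finset.mem_univ, true_and] at hp
      simp only [Finset.sdiff_union_of_subset hp.2.2.1]
    · rintro ⟨V, S⟩ hq
      have hd := hdisj S (Finset.mem_product.1 hq).2
      simp only [Finset.union_sdiff_cancel_right (hd.mono_right hUT)]
    · intro p _; rfl
  have hcard : (all.card : ℝ) = ((U.powersetCard (m ^ 7)).card : ℝ) * ((A.powersetCard k).card : ℝ) := by
    have := hreidx (fun _ => 1)
    simp only [Finset.sum_const, nsmul_eq_mul, mul_one, Finset.card_product, Nat.cast_mul] at this
    exact this
  set E1 := (1 : ℝ) * ((k : ℝ) / A.card) * (y ∩ A).card with hE1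
  set E2 := (3 : ℝ) * (((m ^ 7 : ℕ) : ℝ) / U.card) * (y ∩ U).card with hE2
  have hsum : ∑ p ∈ all, ((3 + 1 : ℝ) ^ (y ∩ p.1).card * (1 + 1 : ℝ) ^ (y ∩ (p.2 \ U)).card)
      ≤ all.card * Real.exp (E1 + E2) := by
    rw [hreidx (fun q => (3 + 1 : ℝ) ^ (y ∩ q.1).card * (1 + 1 : ℝ) ^ (y ∩ q.2).card),
      Finset.sum_product]
    simp only []
    rw [← Finset.sum_mul_sum, hcard, Real.exp_add]
    have a1 := hyp_mgf_aux A y k hkA 1 zero_le_one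
    have a2 := hyp_mgf_aux U y (m ^ 7) h7U 3 (by norm_num)
    refine (mul_le_mul a2 a1 (Finset.sum_nonneg fun _ _ => by positivity) (by positivity)).trans
      (le_of_eq ?_)
    ring
  have hbadsub : bad ⊆ all := by
    intro p hp
    simp only [hbad, hall, Finset.mem_filter] at hp ⊢
    exact ⟨hp.1, hp.2.1⟩
  have hpt : ∀ p ∈ bad, Real.exp (m + (E1 + E2))
      ≤ (3 + 1 : ℝ) ^ (y ∩ p.1).card * (1 + 1 : ℝ) ^ (y ∩ (p.2 \ U)).card := by
    rintro ⟨V, S⟩ hp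
    rw [hbad, Finset.mem_filter] at hp
    replace hp := hp.2
    simp only [nScount, nTcount] at hp
    obtain ⟨⟨g1, g2, g3, g4, g5⟩, g6, g7, g8⟩ := hp
    rw [g5] at g8
    have c1 : (y ∩ S).card = (y ∩ U).card + (y ∩ (S \ U)).card := by
      rw [← Finset.card_union_of_disjoint, ← Finset.inter_union_distrib_left,
        Finset.union_sdiff_of_subset g3]
      exact Finset.disjoint_sdiff.mono Finset.inter_subset_right Finset.inter_subset_right
    have c2 : (y ∩ T).card = (y ∩ U).card + (y ∩ (T \ U)).card := by
      rw [← Finset.card_union_of_disjoint, ← Finset.inter_union_distrib_left,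
        Finset.union_sdiff_of_subset hUT]
      exact Finset.disjoint_sdiff.mono Finset.inter_subset_right Finset.inter_subset_right
    have c3 : y.card = (y ∩ T).card + (y ∩ A).card := by
      rw [← Finset.card_union_of_disjoint, ← Finset.inter_union_distrib_left,
        hA, Finset.union_sdiff_of_subset (Finset.subset_univ _), Finset.inter_univ]
      exact Finset.disjoint_sdiff.mono Finset.inter_subset_right Finset.inter_subset_right
    have key := key_arith_aux m (y ∩ U).card (y ∩ (T \ U)).card (y ∩ A).card
      (((y ∩ (S \ U)).card + 2 * (y ∩ V).card : ℕ) : ℝ) ((k : ℝ) / A.card) hmR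
      (by positivity) (by positivity) (by positivity)
      (by exact_mod_cast (by omega : m ^ 4 ≤ (y ∩ U).card + ((y ∩ (S \ U)).card + 2 * (y ∩ V).card)))
      (by
        rw [c3, c2, c1] at g7
        push_cast at g7 ⊢
        linarith)
      (by exact_mod_cast (by omega : (y ∩ U).card + (y ∩ (T \ U)).card ≤ ((y ∩ (S \ U)).card + 2 * (y ∩ V).card)))
      (by
        have hpos : (0 : ℝ) < A.card := by
          have : 0 < m ^ 13 := by positivity
          exact_mod_cast (by omega : 0 < A.card)
        rw [div_le_div_iff₀ hpos (by positivity)]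
        have : k * m ^ 7 ≤ 2 * A.card := by
          calc k * m ^ 7 ≤ m ^ 13 * m ^ 7 := Nat.mul_le_mul_right _ (Nat.sub_le _ _)
            _ = m ^ 20 := by ring
            _ ≤ 2 * A.card := by omega
        exact_mod_cast this)
    have hUR : (U.card : ℝ) = (m : ℝ) ^ 10 := by rw [hU]; push_cast; rfl
    have h2 : (3 + 1 : ℝ) ^ (y ∩ V).card * (1 + 1 : ℝ) ^ (y ∩ (S \ U)).card
        = Real.exp ((((y ∩ (S \ U)).card + 2 * (y ∩ V).card : ℕ) : ℝ) * Real.log 2) := by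
      rw [Real.exp_nat_mul, Real.exp_log (by norm_num), pow_add, pow_mul]
      norm_num
      ring
    show _ ≤ (3 + 1 : ℝ) ^ (y ∩ V).card * (1 + 1 : ℝ) ^ (y ∩ (S \ U)).card
    rw [h2]
    apply Real.exp_le_exp.2
    rw [hE1, hE2, hUR]
    push_cast at key ⊢
    exact key
  have hfin : (bad.card : ℝ) * Real.exp (m + (E1 + E2)) ≤ all.card * Real.exp (E1 + E2) := by
    calc (bad.card : ℝ) * Real.exp (m + (E1 + E2)) = ∑ p ∈ bad, Real.exp (m + (E1 + E2)) := by
          rw [Finset.sum_const, nsmul_eq_mul]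
      _ ≤ _ := Finset.sum_le_sum hpt
      _ ≤ _ := Finset.sum_le_sum_of_subset_of_nonneg hbadsub (fun _ _ _ => by positivity)
      _ ≤ _ := hsum
  rw [Real.exp_add, ← mul_assoc] at hfin
  have hfin2 := le_of_mul_le_mul_right hfin (Real.exp_pos _)
  apply div_le_of_le_mul₀ (by positivity) (by positivity)
  rw [one_mul, Real.exp_neg, inv_mul_eq_div, le_div_iff₀ (Real.exp_pos _)]
  exact hfin2
end

section
/- Fix n (a perfect 20th power, sufficiently large) and set t = n^(1/5), r = n^(3/20), γ = n^(-1/10), v = n^(-7/10). Let (V,S,T) be an admissible triple with U = S∩T and take α = 1. Suppose M is a randomized allocation rule mapping each input y ⊆ [n] to a probability distribution over the feasible set F_{V,S,T,1} = {x_S^1, x_T^1, x_{[n]}^γ}, and suppose that on input V the expected allocation of M to each agent of U is at most n^(−1/20). Then the expected welfare of M on input V is at most 2·n^(3/10), whereas the feasible allocation x_S^1 has welfare at least |V| = n^(7/20) on input V; consequently the worst-case approximation ratio of M for the welfare-maximization problem with feasible set F_{V,S,T,1} is at most 2·n^(−1/20). -/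
/-!
Statement 5: with `α = 1`, if a randomized allocation rule `M` over the feasible set
`F_{V,S,T,1} = {x_S^1, x_T^1, x_{[n]}^γ}` allocates in expectation at most `n^{-1/20}`
to each agent of `U` on input `V`, then its expected welfare on input `V` is at most
`2·n^{3/10} = 2m^6`, whereas `x_S^1` has welfare at least `|V| = n^{7/20} = m^7` on
input `V`; hence the worst-case approximation ratio of `M` is at most
`2·n^{-1/20} = 2m⁻¹`.  Here `n = m^20`, `γ = m^{-2}`, `v = m^{-14}`.
The rule `M` is described by probabilities `q1 y, q2 y, q3 y` of returning
`x_S^1, x_T^1, x_{[n]}^γ` respectively on input `y`.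
-/

open Finset
open scoped Classical

noncomputable section

/-- Expected welfare of the randomized rule `(q1,q2,q3)` on input `y`. -/
def expWelfare {n : ℕ} (v γ : ℝ) (S T : Finset (Fin n))
    (q1 q2 q3 : Finset (Fin n) → ℝ) (y : Finset (Fin n)) : ℝ :=
  q1 y * welfare v y (alloc S 1) + q2 y * welfare v y (alloc T 1) +
    q3 y * welfare v y (alloc Finset.univ γ)

/-- Best feasible welfare on input `y`. -/
def optWelfare {n : ℕ} (v γ : ℝ) (S T : Finset (Fin n)) (y : Finset (Fin n)) : ℝ :=
  max (welfare v y (alloc S 1))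
    (max (welfare v y (alloc T 1)) (welfare v y (alloc Finset.univ γ)))

lemma welfare_bounds {n : ℕ} (v a : ℝ) (hv : 0 ≤ v) (ha : 0 ≤ a) (V W : Finset (Fin n))
    (h : V ⊆ W) :
    (V.card : ℝ) * a ≤ welfare v V (alloc W a) ∧
      welfare v V (alloc W a) ≤ (V.card : ℝ) * a + v * ((W.card : ℝ) * a) := by
  have h1 : ∑ i ∈ V, alloc W a i = (V.card : ℝ) * a := by
    rw [Finset.sum_congr rfl (g := fun _ => a)]
    · simp
    · intro i hi
      simp [alloc, h hi]
  have hnn : ∀ i, 0 ≤ alloc W a i := by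
    intro i
    unfold alloc
    split_ifs <;> simp [ha]
  have h2 : 0 ≤ ∑ i ∈ Vᶜ, alloc W a i := Finset.sum_nonneg fun i _ => hnn i
  have h3 : ∑ i ∈ Vᶜ, alloc W a i ≤ (W.card : ℝ) * a := by
    calc ∑ i ∈ Vᶜ, alloc W a i ≤ ∑ i, alloc W a i :=
          Finset.sum_le_sum_of_subset_of_nonneg (Finset.subset_univ _) fun i _ _ => hnn i
      _ = (W.card : ℝ) * a := by simp [alloc]
  unfold welfare
  rw [h1]
  exact ⟨by nlinarith [mul_nonneg hv h2], by nlinarith [mul_le_mul_of_nonneg_left h3 hv]⟩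

theorem stmt5 :
    ∃ n₀ : ℕ, ∀ m : ℕ, n₀ ≤ m →
      ∀ V S T : Finset (Fin (m ^ 20)),
        S.card = m ^ 13 → T.card = m ^ 13 → (S ∩ T).card = m ^ 10 →
        V ⊆ S ∩ T → V.card = m ^ 7 →
        ∀ q1 q2 q3 : Finset (Fin (m ^ 20)) → ℝ,
          (∀ y, 0 ≤ q1 y) → (∀ y, 0 ≤ q2 y) → (∀ y, 0 ≤ q3 y) →
          (∀ y, q1 y + q2 y + q3 y = 1) →
          -- on input `V`, the expected allocation to each agent of `U` is at most `n^{-1/20}`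
          (q1 V * 1 + q2 V * 1 + q3 V * ((m : ℝ) ^ 2)⁻¹ ≤ ((m : ℝ))⁻¹) →
          expWelfare (((m : ℝ) ^ 14)⁻¹) (((m : ℝ) ^ 2)⁻¹) S T q1 q2 q3 V
              ≤ 2 * (m : ℝ) ^ 6
          ∧ ((m : ℝ) ^ 7) ≤ welfare (((m : ℝ) ^ 14)⁻¹) V (alloc S 1)
          ∧ Finset.univ.inf' ⟨∅, Finset.mem_univ ∅⟩
              (fun y : Finset (Fin (m ^ 20)) =>
                expWelfare (((m : ℝ) ^ 14)⁻¹) (((m : ℝ) ^ 2)⁻¹) S T q1 q2 q3 y /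
                  optWelfare (((m : ℝ) ^ 14)⁻¹) (((m : ℝ) ^ 2)⁻¹) S T y)
              ≤ 2 * ((m : ℝ))⁻¹ := by
  refine ⟨2, ?_⟩
  intro m hm V S T hS hT _ hVU hV q1 q2 q3 h1 h2 h3 hsum hq
  have hm2 : (2 : ℝ) ≤ m := by exact_mod_cast hm
  have hm0 : (0 : ℝ) < m := by linarith
  have hv : (0 : ℝ) ≤ ((m : ℝ) ^ 14)⁻¹ := by positivity
  have hg : (0 : ℝ) ≤ ((m : ℝ) ^ 2)⁻¹ := by positivity
  obtain ⟨lS, uS⟩ := welfare_bounds _ 1 hv zero_le_one V S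
    (hVU.trans Finset.inter_subset_left)
  obtain ⟨_, uT⟩ := welfare_bounds _ 1 hv zero_le_one V T
    (hVU.trans Finset.inter_subset_right)
  obtain ⟨_, uA⟩ := welfare_bounds _ _ hv hg V Finset.univ (Finset.subset_univ _)
  rw [hV, hS] at uS
  rw [hV, hT] at uT
  rw [hV, Finset.card_univ, Fintype.card_fin] at uA
  rw [hV] at lS
  push_cast at lS uS uT uA
  have e1 : (m : ℝ) ^ 7 * 1 + ((m : ℝ) ^ 14)⁻¹ * ((m : ℝ) ^ 13 * 1) = (m : ℝ) ^ 7 + (m : ℝ)⁻¹ := by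
    field_simp
  have e2 : (m : ℝ) ^ 7 * ((m : ℝ) ^ 2)⁻¹ + ((m : ℝ) ^ 14)⁻¹ * ((m : ℝ) ^ 20 * ((m : ℝ) ^ 2)⁻¹)
      = (m : ℝ) ^ 5 + (m : ℝ) ^ 4 := by
    field_simp
  rw [e1] at uS uT
  rw [e2] at uA
  have hW : (m : ℝ) ^ 7 ≤ welfare (((m : ℝ) ^ 14)⁻¹) V (alloc S 1) := by linarith
  have hE : expWelfare (((m : ℝ) ^ 14)⁻¹) (((m : ℝ) ^ 2)⁻¹) S T q1 q2 q3 V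
      ≤ 2 * (m : ℝ) ^ 6 := by
    unfold expWelfare
    have a1 := mul_le_mul_of_nonneg_left uS (h1 V)
    have a2 := mul_le_mul_of_nonneg_left uT (h2 V)
    have a3 := mul_le_mul_of_nonneg_left uA (h3 V)
    have b := mul_le_mul_of_nonneg_left hq (by positivity : (0 : ℝ) ≤ (m : ℝ) ^ 7)
    have c1 : (m : ℝ) ^ 7 * (m : ℝ)⁻¹ = (m : ℝ) ^ 6 := by field_simp
    have c2 : (m : ℝ) ^ 7 * (q1 V * 1 + q2 V * 1 + q3 V * ((m : ℝ) ^ 2)⁻¹)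
        = (q1 V + q2 V) * (m : ℝ) ^ 7 + q3 V * (m : ℝ) ^ 5 := by
      field_simp
    rw [c1, c2] at b
    have i1 : (m : ℝ)⁻¹ ≤ 1 := inv_le_one_of_one_le₀ (by linarith)
    have hp : (1 : ℝ) ≤ (m : ℝ) ^ 4 := one_le_pow₀ (by linarith)
    have hp6 : 2 * (m : ℝ) ^ 4 ≤ (m : ℝ) ^ 6 := by
      have : (m : ℝ) ^ 6 = (m : ℝ) ^ 2 * (m : ℝ) ^ 4 := by ring
      rw [this]
      exact mul_le_mul_of_nonneg_right (by nlinarith) (by positivity)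
    have d1 : (q1 V + q2 V) * (m : ℝ)⁻¹ ≤ (q1 V + q2 V) * (m : ℝ) ^ 4 :=
      mul_le_mul_of_nonneg_left (by linarith) (by linarith [h1 V, h2 V])
    have d2 : (q1 V + q2 V) * (m : ℝ) ^ 4 + q3 V * (m : ℝ) ^ 4 = (m : ℝ) ^ 4 := by
      rw [← add_mul, hsum V, one_mul]
    linarith
  refine ⟨hE, hW, ?_⟩
  refine (Finset.inf'_le _ (Finset.mem_univ V)).trans ?_
  have hO : (m : ℝ) ^ 7 ≤ optWelfare (((m : ℝ) ^ 14)⁻¹) (((m : ℝ) ^ 2)⁻¹) S T V :=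
    hW.trans (le_max_left _ _)
  have hp7 : (0 : ℝ) < (m : ℝ) ^ 7 := by positivity
  rw [div_le_iff₀ (lt_of_lt_of_le hp7 hO)]
  have k := mul_le_mul_of_nonneg_left hO (by positivity : (0 : ℝ) ≤ 2 * (m : ℝ)⁻¹)
  have k2 : 2 * (m : ℝ)⁻¹ * (m : ℝ) ^ 7 = 2 * (m : ℝ) ^ 6 := by field_simp
  linarith

end
end

section
/- Fix n and a real α ≥ 1, and let M be any randomized allocation rule. Suppose that for every v ∈ {1,α}^n, Pr[U(v) and not B | v] ≤ (ln 4)·e^(−n^(1/4)/2). Then (1/(2n))·Σ_{i=1}^n p_i^0(1) ≤ n^(−1/4) + Pr[B] + (ln 4)·e^(−n^(1/4)/2). -/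
/-!
Statement 9 (Lemma "zero-one"): for any randomized allocation rule `M` on speed
vectors `v ∈ {1,α}^n` (encoded by the high-speed set `H = {i : v_i = α}`, uniform
over subsets, with internal randomness a finite probability space `(Ω,μ)`), if for
every `v` the conditional probability `Pr[U(v) ∧ ¬B | v]` is at most
`(ln 4)·e^{−n^{1/4}/2}`, then
`(1/(2n))·Σ_i p_i^0(1) ≤ n^{−1/4} + Pr[B] + (ln 4)·e^{−n^{1/4}/2}`.
-/

open Finset
open scoped Classical

noncomputable section

/-- Real-valued indicator of a proposition. -/
def ind (P : Prop) : ℝ := if P then 1 else 0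

/-- Event `B` at `(H,ω)`: some agent `i` with `v_i = 1` receives allocation `α`. -/
def Bev {n : ℕ} {Ω : Type} (α : ℝ) (M : Finset (Fin n) → Ω → Fin n → ℝ)
    (H : Finset (Fin n)) (ω : Ω) : Prop :=
  ∃ i, i ∉ H ∧ M H ω i = α

/-- Event `U(v)` at `(H,ω)`: at least `n^{3/4}` agents `i` have `v_i = 1` and `x_i = 0`. -/
def Uev {n : ℕ} {Ω : Type} (M : Finset (Fin n) → Ω → Fin n → ℝ)
    (H : Finset (Fin n)) (ω : Ω) : Prop :=
  (n : ℝ) ^ ((3 : ℝ) / 4) ≤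
    ((Finset.univ.filter (fun i : Fin n => i ∉ H ∧ M H ω i = 0)).card : ℝ)

/-- `Pr[B]`, over the uniform random `H` and the randomness of `M`. -/
def prB {n : ℕ} {Ω : Type} [Fintype Ω] (α : ℝ) (μ : Ω → ℝ)
    (M : Finset (Fin n) → Ω → Fin n → ℝ) : ℝ :=
  (∑ H : Finset (Fin n), ∑ ω : Ω, μ ω * ind (Bev α M H ω)) / 2 ^ n

/-- `p_i^s(1) = Pr[x_i = s | v_i = 1]`. -/
def pLow {n : ℕ} {Ω : Type} [Fintype Ω] (μ : Ω → ℝ)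
    (M : Finset (Fin n) → Ω → Fin n → ℝ) (i : Fin n) (s : ℝ) : ℝ :=
  (∑ H ∈ Finset.univ.filter (fun H : Finset (Fin n) => i ∉ H),
      ∑ ω : Ω, μ ω * ind (M H ω i = s)) / 2 ^ (n - 1)

theorem stmt9 (n : ℕ) (α : ℝ) (hα : 1 ≤ α)
    (Ω : Type) [Fintype Ω] (μ : Ω → ℝ)
    (hμ0 : ∀ ω, 0 ≤ μ ω) (hμ1 : ∑ ω, μ ω = 1)
    (M : Finset (Fin n) → Ω → Fin n → ℝ)
    (hvals : ∀ H ω i, M H ω i = 0 ∨ M H ω i = 1 ∨ M H ω i = α)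
    (hU : ∀ H : Finset (Fin n),
      (∑ ω : Ω, μ ω * ind (Uev M H ω ∧ ¬Bev α M H ω))
        ≤ Real.log 4 * Real.exp (-(n : ℝ) ^ ((1 : ℝ) / 4) / 2)) :
    (1 / (2 * (n : ℝ))) * ∑ i : Fin n, pLow μ M i 0
      ≤ (n : ℝ) ^ (-(1 : ℝ) / 4) + prB α μ M +
        Real.log 4 * Real.exp (-(n : ℝ) ^ ((1 : ℝ) / 4) / 2) := by
  have hind0 : ∀ P : Prop, 0 ≤ ind P := fun P => by unfold ind; split_ifs <;> norm_num
  have hprB : 0 ≤ prB α μ M := by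
    unfold prB
    exact div_nonneg (Finset.sum_nonneg fun H _ => Finset.sum_nonneg fun ω _ =>
      mul_nonneg (hμ0 ω) (hind0 _)) (by positivity)
  set L : ℝ := Real.log 4 * Real.exp (-(n : ℝ) ^ ((1 : ℝ) / 4) / 2) with hL
  have hL0 : 0 ≤ L := mul_nonneg (Real.log_nonneg (by norm_num)) (Real.exp_pos _).le
  rcases Nat.eq_zero_or_pos n with hn | hn
  · have h1 : (1 / (2 * (n : ℝ))) = 0 := by simp [hn]
    have h2 : 0 ≤ (n : ℝ) ^ (-(1 : ℝ) / 4) := by positivity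
    rw [h1, zero_mul]
    linarith
  have hnR : (0 : ℝ) < n := by exact_mod_cast hn
  -- the number of slow agents which receive nothing
  let C : Finset (Fin n) → Ω → ℝ := fun H ω =>
    ((Finset.univ.filter (fun i : Fin n => i ∉ H ∧ M H ω i = 0)).card : ℝ)
  have hpow : (n : ℝ) ^ ((3 : ℝ) / 4) = n * (n : ℝ) ^ (-(1 : ℝ) / 4) := by
    rw [← Real.rpow_one_add' hnR.le (by norm_num)]
    norm_num
  have hC : ∀ H ω, C H ω ≤ n * ((n : ℝ) ^ (-(1 : ℝ) / 4) + ind (Bev α M H ω)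
      + ind (Uev M H ω ∧ ¬Bev α M H ω)) := by
    intro H ω
    have hcard : C H ω ≤ n := by
      have := Finset.card_le_univ (Finset.univ.filter (fun i : Fin n => i ∉ H ∧ M H ω i = 0))
      rw [Fintype.card_fin] at this
      simp only [C]
      exact_mod_cast this
    have hp : 0 < (n : ℝ) ^ (-(1 : ℝ) / 4) := by positivity
    by_cases hB : Bev α M H ω
    · simp only [ind, hB]
      simp
      nlinarith
    · by_cases hUe : Uev M H ω
      · simp only [ind, hB, hUe]
        simp
        nlinarith
      · have h3 : C H ω < (n : ℝ) ^ ((3 : ℝ) / 4) := not_le.mp hUe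
        simp only [ind, hB, hUe]
        simp
        rw [← hpow]
        exact h3.le
  have hsum : ∑ i : Fin n, pLow μ M i 0
      = (∑ H : Finset (Fin n), ∑ ω : Ω, μ ω * C H ω) / 2 ^ (n - 1) := by
    unfold pLow
    rw [← Finset.sum_div]
    congr 1
    simp_rw [Finset.sum_filter]
    rw [Finset.sum_comm]
    refine Finset.sum_congr rfl fun H _ => ?_
    have h4 : ∀ i : Fin n, (if i ∉ H then ∑ ω : Ω, μ ω * ind (M H ω i = 0) else 0)
        = ∑ ω : Ω, μ ω * (if i ∉ H ∧ M H ω i = 0 then 1 else 0) := by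
      intro i
      by_cases hi : i ∈ H <;> simp [hi, ind]
    rw [Finset.sum_congr rfl fun i _ => h4 i, Finset.sum_comm]
    refine Finset.sum_congr rfl fun ω _ => ?_
    rw [← Finset.mul_sum]
    simp only [C]
    rw [Finset.card_filter]
    push_cast
    rfl
  have hH : ∀ H : Finset (Fin n), ∑ ω : Ω, μ ω * C H ω ≤
      n * ((n : ℝ) ^ (-(1 : ℝ) / 4) + (∑ ω : Ω, μ ω * ind (Bev α M H ω)) + L) := by
    intro H
    calc ∑ ω : Ω, μ ω * C H ω
        ≤ ∑ ω : Ω, μ ω * (n * ((n : ℝ) ^ (-(1 : ℝ) / 4) + ind (Bev α M H ω)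
            + ind (Uev M H ω ∧ ¬Bev α M H ω))) :=
          Finset.sum_le_sum fun ω _ => mul_le_mul_of_nonneg_left (hC H ω) (hμ0 ω)
      _ = n * ((∑ ω : Ω, μ ω) * (n : ℝ) ^ (-(1 : ℝ) / 4) + (∑ ω : Ω, μ ω * ind (Bev α M H ω))
            + ∑ ω : Ω, μ ω * ind (Uev M H ω ∧ ¬Bev α M H ω)) := by
          rw [Finset.sum_mul, ← Finset.sum_add_distrib, ← Finset.sum_add_distrib, Finset.mul_sum]
          exact Finset.sum_congr rfl fun ω _ => by ring
      _ ≤ _ := by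
          rw [hμ1, one_mul]
          exact mul_le_mul_of_nonneg_left (by linarith [hU H]) hnR.le
  have htot : ∑ H : Finset (Fin n), ∑ ω : Ω, μ ω * C H ω ≤
      n * 2 ^ n * ((n : ℝ) ^ (-(1 : ℝ) / 4) + prB α μ M + L) := by
    refine (Finset.sum_le_sum fun H _ => hH H).trans (le_of_eq ?_)
    rw [← Finset.mul_sum, Finset.sum_add_distrib, Finset.sum_add_distrib]
    simp only [Finset.sum_const, Finset.card_univ, Fintype.card_finset, Fintype.card_fin,
      nsmul_eq_mul]
    unfold prB
    push_cast
    field_simp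
  rw [hsum]
  have h2n : (2 : ℝ) ^ n = 2 * 2 ^ (n - 1) := by
    rw [← pow_succ', Nat.sub_add_cancel hn]
  have h5 : (1 / (2 * (n : ℝ))) * ((∑ H : Finset (Fin n), ∑ ω : Ω, μ ω * C H ω) / 2 ^ (n - 1))
      = (∑ H : Finset (Fin n), ∑ ω : Ω, μ ω * C H ω) / (n * 2 ^ n) := by
    rw [h2n]
    field_simp
  rw [h5, div_le_iff₀ (by positivity)]
  linarith

end
end

section
/- Set α = n^(1/2)/36. Let M be a randomized allocation rule all of whose output allocations lie in the family 𝒳, suppose that for every v ∈ {1,α}^n, Pr[U(v) and not B | v] ≤ (ln 4)·e^(−n^(1/4)/2), and suppose M satisfies the Bayesian incentive compatibility condition: for every agent i, E[x_i | v_i = α] ≥ E[x_i | v_i = 1]. Then for all sufficiently large n, Pr[B] ≥ n^(−1/4) − 2·e^(−n^(1/4)/4) − (ln 4)·e^(−n^(1/4)/2). In particular, the expected makespan of M is at least 1 + α·(n^(−1/4) − 2·e^(−n^(1/4)/4) − (ln 4)·e^(−n^(1/4)/2)), which exceeds (1/36)·n^(1/4)·(1 − o(1)). -/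
/-!
Statement 12: with `α = n^{1/2}/36`, any randomized allocation rule `M` whose outputs
lie in the family `𝒳`, with `Pr[U(v) ∧ ¬B | v] ≤ (ln 4)·e^{−n^{1/4}/2}` for every `v`,
and satisfying the BIC monotonicity condition `E[x_i | v_i = α] ≥ E[x_i | v_i = 1]`
for every agent `i`, must (for sufficiently large `n`) satisfy
`Pr[B] ≥ n^{−1/4} − 2e^{−n^{1/4}/4} − (ln 4)·e^{−n^{1/4}/2}`; in particular its
expected makespan is at least `1 + α·(n^{−1/4} − 2e^{−n^{1/4}/4} − (ln 4)·e^{−n^{1/4}/2})`,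
which exceeds `(1/36)·n^{1/4}·(1 − ε)` for any fixed `ε > 0` and `n` large.
Speed vectors `v ∈ {1,α}^n` are encoded by the high-speed set `H = {i : v_i = α}`,
uniform over subsets; the rule's internal randomness is a finite space `(Ω,μ)`.
-/

open Finset
open scoped Classical

noncomputable section

/-- Expected allocation to agent `i` conditioned on `v_i = 1`. -/
def eLow {n : ℕ} {Ω : Type} [Fintype Ω] (μ : Ω → ℝ)
    (M : Finset (Fin n) → Ω → Fin n → ℝ) (i : Fin n) : ℝ :=
  (∑ H ∈ Finset.univ.filter (fun H : Finset (Fin n) => i ∉ H),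
      ∑ ω : Ω, μ ω * M H ω i) / 2 ^ (n - 1)

/-- Expected allocation to agent `i` conditioned on `v_i = α`. -/
def eHigh {n : ℕ} {Ω : Type} [Fintype Ω] (μ : Ω → ℝ)
    (M : Finset (Fin n) → Ω → Fin n → ℝ) (i : Fin n) : ℝ :=
  (∑ H ∈ Finset.univ.filter (fun H : Finset (Fin n) => i ∈ H),
      ∑ ω : Ω, μ ω * M H ω i) / 2 ^ (n - 1)

/-- Makespan of allocation `x` on the speed vector with high-speed set `H`. -/
def mkspan {n : ℕ} (α : ℝ) (H : Finset (Fin n)) (x : Fin n → ℝ) : ℝ :=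
  ⨆ i : Fin n, x i / (if i ∈ H then α else 1)

/-- Expected makespan of the rule `M`. -/
def expMk {n : ℕ} {Ω : Type} [Fintype Ω] (α : ℝ) (μ : Ω → ℝ)
    (M : Finset (Fin n) → Ω → Fin n → ℝ) : ℝ :=
  (∑ H : Finset (Fin n), ∑ ω : Ω, μ ω * mkspan α H (M H ω)) / 2 ^ n

/-- The family `𝒳` of allocations: type 1 — given `H'` with
`n/2 − n^{3/4} ≤ |H'| ≤ n/2 + n^{3/4}` and `S ⊆ H'` with `|S| ≤ n^{1/2}`, allocate `α`
on `S`, `0` on `H'∖S` and `1` outside `H'`; type 2 — given `S` with `|S| = n^{3/4}`,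
allocate `α` on `S` and `0` elsewhere. -/
def inFam {n : ℕ} (α : ℝ) (x : Fin n → ℝ) : Prop :=
  (∃ H' S : Finset (Fin n), S ⊆ H' ∧
      (n : ℝ) / 2 - (n : ℝ) ^ ((3 : ℝ) / 4) ≤ (H'.card : ℝ) ∧
      (H'.card : ℝ) ≤ (n : ℝ) / 2 + (n : ℝ) ^ ((3 : ℝ) / 4) ∧
      (S.card : ℝ) ≤ (n : ℝ) ^ ((1 : ℝ) / 2) ∧
      (∀ i, x i = if i ∈ S then α else if i ∈ H' then 0 else 1)) ∨
  (∃ S : Finset (Fin n), (S.card : ℝ) = (n : ℝ) ^ ((3 : ℝ) / 4) ∧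
      (∀ i, x i = if i ∈ S then α else 0))

lemma pw_sum {β : Type*} [DecidableEq β] (s : Finset β) :
    ∑ H ∈ s.powerset, ((s.card : ℝ) - 2 * (H.card : ℝ)) = 0 := by
  induction s using Finset.induction_on with
  | empty => simp
  | insert a s ha ih =>
    rw [Finset.sum_powerset_insert ha, ← Finset.sum_add_distrib]
    have : ∀ H ∈ s.powerset, (((insert a s).card : ℝ) - 2 * (H.card : ℝ)) +
        (((insert a s).card : ℝ) - 2 * ((insert a H).card : ℝ)) =
        2 * ((s.card : ℝ) - 2 * (H.card : ℝ)) := by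
      intro H hH
      have hb : a ∉ H := fun h => ha (Finset.mem_powerset.1 hH h)
      rw [Finset.card_insert_of_notMem ha, Finset.card_insert_of_notMem hb]
      push_cast; ring
    rw [Finset.sum_congr rfl this, ← Finset.mul_sum, ih, mul_zero]

lemma pw_sq {β : Type*} [DecidableEq β] (s : Finset β) :
    ∑ H ∈ s.powerset, ((s.card : ℝ) - 2 * (H.card : ℝ)) ^ 2 = (s.card : ℝ) * 2 ^ s.card := by
  induction s using Finset.induction_on with
  | empty => simp
  | insert a s ha ih =>
    rw [Finset.sum_powerset_insert ha, ← Finset.sum_add_distrib]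
    have : ∀ H ∈ s.powerset, (((insert a s).card : ℝ) - 2 * (H.card : ℝ)) ^ 2 +
        (((insert a s).card : ℝ) - 2 * ((insert a H).card : ℝ)) ^ 2 =
        2 * ((s.card : ℝ) - 2 * (H.card : ℝ)) ^ 2 + 2 := by
      intro H hH
      have hb : a ∉ H := fun h => ha (Finset.mem_powerset.1 hH h)
      rw [Finset.card_insert_of_notMem ha, Finset.card_insert_of_notMem hb]
      push_cast; ring
    rw [Finset.sum_congr rfl this, Finset.sum_add_distrib, ← Finset.mul_sum, ih,
      Finset.card_insert_of_notMem ha]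
    simp
    ring

/-- Number of low agents minus number of high agents. -/
def Wd {n : ℕ} (H : Finset (Fin n)) : ℝ := (n : ℝ) - 2 * (H.card : ℝ)

lemma Wd_sum (n : ℕ) : ∑ H : Finset (Fin n), Wd H = 0 := by
  simpa [Wd] using pw_sum (Finset.univ : Finset (Fin n))

lemma Wd_sq (n : ℕ) : ∑ H : Finset (Fin n), Wd H ^ 2 = n * 2 ^ n := by
  simpa [Wd] using pw_sq (Finset.univ : Finset (Fin n))

/-- Sign of an agent: `1` if low, `-1` if high. -/
def sg {n : ℕ} (H : Finset (Fin n)) (i : Fin n) : ℝ := if i ∈ H then -1 else 1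

lemma sg_sum {n : ℕ} (H : Finset (Fin n)) : ∑ i, sg H i = Wd H := by
  have : ∀ i, sg H i = 1 - 2 * (if i ∈ H then (1:ℝ) else 0) := by
    intro i; unfold sg; split_ifs <;> norm_num
  simp only [this, Finset.sum_sub_distrib, ← Finset.mul_sum]
  simp [Wd]

lemma ind_nonneg (P : Prop) : 0 ≤ ind P := by unfold ind; split_ifs <;> norm_num

lemma fam_pos {n : ℕ} {α : ℝ} (hα : 0 ≤ α) {x : Fin n → ℝ} (hx : inFam α x) (i : Fin n) :
    0 ≤ x i := by
  rcases hx with ⟨H', S, -, -, -, -, h⟩ | ⟨S, -, h⟩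
  · rw [h i]; split_ifs <;> simp [hα]
  · rw [h i]; split_ifs <;> simp [hα]

lemma Wd_small {n : ℕ} (t : ℝ) (ht : 10000 ≤ t) (hn : (n : ℝ) = t ^ 4) (H : Finset (Fin n))
    (h : ((Finset.univ.filter (fun i : Fin n => i ∉ H)).card : ℝ) < t ^ 3) :
    1 ≤ 4 * Wd H ^ 2 / t ^ 8 := by
  have hc : ((Finset.univ.filter (fun i : Fin n => i ∉ H)).card : ℝ) = n - H.card := by
    have := Finset.card_compl H
    have e : (Finset.univ.filter (fun i : Fin n => i ∉ H)) = Hᶜ := by ext; simp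
    rw [e, Finset.card_compl, Nat.cast_sub (Finset.card_le_univ H)]; simp
  rw [hc] at h
  have h3 : 0 < t ^ 3 := by positivity
  have h4 : t ^ 4 = t * t ^ 3 := by ring
  have hW : t ^ 4 / 2 ≤ - Wd H := by
    unfold Wd; nlinarith
  rw [le_div_iff₀ (by positivity)]
  have : (t ^ 4 / 2) ^ 2 ≤ (- Wd H) ^ 2 := by gcongr
  nlinarith

lemma pointwise {n : ℕ} (t : ℝ) (ht : 10000 ≤ t) (hn : (n : ℝ) = t ^ 4)
    (h34 : (n : ℝ) ^ ((3 : ℝ) / 4) = t ^ 3) (h12 : (n : ℝ) ^ ((1 : ℝ) / 2) = t ^ 2)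
    {Ω : Type} (M : Finset (Fin n) → Ω → Fin n → ℝ) (H : Finset (Fin n)) (ω : Ω)
    (hx : inFam (t ^ 2 / 36) (M H ω)) :
    Wd H + 17 / 36 * t ^ 4 - 3 * t ^ 3 - (t ^ 5 / 36 + 2 * t ^ 4) *
      (ind (Bev (t ^ 2 / 36) M H ω) + ind (Uev M H ω ∧ ¬ Bev (t ^ 2 / 36) M H ω) +
        4 * Wd H ^ 2 / t ^ 8) ≤ ∑ i, sg H i * M H ω i := by
  have hpos := fam_pos (by positivity) hx
  have h3 : 0 < t ^ 3 := by positivity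
  have h4 : t ^ 4 = t * t ^ 3 := by ring
  have h5 : t ^ 5 = t * t ^ 4 := by ring
  have h40 : 0 < t ^ 4 := by positivity
  have hWle : Wd H ≤ t ^ 4 := by
    unfold Wd; rw [hn]; have : (0:ℝ) ≤ H.card := by positivity
    linarith
  have hWsq : 0 ≤ 4 * Wd H ^ 2 / t ^ 8 := by positivity
  have hB0 := ind_nonneg (Bev (t ^ 2 / 36) M H ω)
  have hU0 := ind_nonneg (Uev M H ω ∧ ¬ Bev (t ^ 2 / 36) M H ω)
  have hK : 0 ≤ t ^ 5 / 36 + 2 * t ^ 4 := by positivity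
  -- crude bound
  have hD1 : - ∑ i, M H ω i ≤ ∑ i, sg H i * M H ω i := by
    rw [← Finset.sum_neg_distrib]
    apply Finset.sum_le_sum
    intro i _
    have := hpos i
    unfold sg; split_ifs <;> linarith
  have hD2 : ∑ i, M H ω i ≤ t ^ 5 / 36 := by
    rcases hx with ⟨H', S, -, -, -, hS, h⟩ | ⟨S, hS, h⟩
    · have : ∀ i, M H ω i ≤ (if i ∈ S then t ^ 2 / 36 else 0) + 1 := by
        intro i; rw [h i]
        have : 0 ≤ t ^ 2 := by positivity
        split_ifs <;> linarith
      have h1 := Finset.sum_le_sum (fun i (_ : i ∈ Finset.univ) => this i)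
      rw [Finset.sum_add_distrib, ← Finset.sum_filter] at h1
      simp at h1
      rw [hn] at h1
      rw [h12] at hS
      have : (S.card : ℝ) * (t ^ 2 / 36) ≤ t ^ 2 * (t ^ 2 / 36) := by gcongr
      nlinarith
    · rw [Finset.sum_congr rfl (fun i _ => h i), ← Finset.sum_filter]
      simp
      rw [hS, h34]
      apply le_of_eq; ring
  have crude : 1 ≤ ind (Bev (t ^ 2 / 36) M H ω) + ind (Uev M H ω ∧ ¬ Bev (t ^ 2 / 36) M H ω) +
        4 * Wd H ^ 2 / t ^ 8 → Wd H + 17 / 36 * t ^ 4 - 3 * t ^ 3 - (t ^ 5 / 36 + 2 * t ^ 4) *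
      (ind (Bev (t ^ 2 / 36) M H ω) + ind (Uev M H ω ∧ ¬ Bev (t ^ 2 / 36) M H ω) +
        4 * Wd H ^ 2 / t ^ 8) ≤ ∑ i, sg H i * M H ω i := by
    intro h
    have := mul_le_mul_of_nonneg_left h hK
    linarith
  by_cases hB : Bev (t ^ 2 / 36) M H ω
  · apply crude
    have : ind (Bev (t ^ 2 / 36) M H ω) = 1 := by simp [ind, hB]
    linarith
  by_cases hU : Uev M H ω
  · apply crude
    have : ind (Uev M H ω ∧ ¬ Bev (t ^ 2 / 36) M H ω) = 1 := by simp [ind, hB, hU]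
    linarith
  have hU' := hU
  unfold Uev at hU'
  rw [h34, not_le] at hU'
  have hBn : ∀ i, M H ω i = t ^ 2 / 36 → i ∈ H := by
    intro i hi; by_contra hc; exact hB ⟨i, hc, hi⟩
  rcases hx with ⟨H', S, hSH, hl, -, hS, h⟩ | ⟨S, hS, h⟩
  · have hp : ∀ i, -(if i ∈ S then t ^ 2 / 36 else 0) + sg H i + (if i ∈ H' then 1 else 0)
        - 2 * (if i ∉ H ∧ M H ω i = 0 then 1 else 0) ≤ sg H i * M H ω i := by
      intro i
      have hi := h i
      by_cases h1 : i ∈ S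
      · have h2 := hSH h1
        simp only [h1, if_true] at hi
        have h3 := hBn i hi
        simp [h1, h2, h3, sg, hi]
      · by_cases h2 : i ∈ H'
        · simp only [h1, h2, if_true, if_false] at hi
          by_cases h3 : i ∈ H <;> simp [h1, h2, h3, sg, hi]
          norm_num
        · simp only [h1, h2, if_false] at hi
          by_cases h3 : i ∈ H <;> simp [h1, h2, h3, sg, hi]
    have h1 := Finset.sum_le_sum (fun i (_ : i ∈ Finset.univ) => hp i)
    rw [Finset.sum_sub_distrib, Finset.sum_add_distrib, Finset.sum_add_distrib, sg_sum,
      Finset.sum_neg_distrib, ← Finset.mul_sum, Finset.sum_boole, Finset.sum_boole] at h1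
    simp only [Finset.sum_ite_mem, Finset.univ_inter, Finset.sum_const, nsmul_eq_mul,
      Finset.filter_univ_mem] at h1
    rw [h12] at hS
    rw [h34, hn] at hl
    have h2 : (S.card : ℝ) * (t ^ 2 / 36) ≤ t ^ 2 * (t ^ 2 / 36) := by gcongr
    have h6 : t ^ 2 * (t ^ 2 / 36) = t ^ 4 / 36 := by ring
    have h7 := mul_nonneg hK (by linarith : 0 ≤ ind (Bev (t ^ 2 / 36) M H ω) + ind (Uev M H ω ∧ ¬ Bev (t ^ 2 / 36) M H ω) +
        4 * Wd H ^ 2 / t ^ 8)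
    linarith
  · apply crude
    have : 1 ≤ 4 * Wd H ^ 2 / t ^ 8 := by
      apply Wd_small t ht hn
      refine lt_of_le_of_lt ?_ hU'
      norm_cast
      apply Finset.card_le_card
      intro i
      simp only [Finset.mem_filter, Finset.mem_univ, true_and]
      intro hi
      refine ⟨hi, ?_⟩
      have h1 := h i
      by_cases h2 : i ∈ S
      · simp only [h2, if_true] at h1
        exact absurd (hBn i h1) hi
      · simpa [h2] using h1
    linarith

lemma mk_pointwise {n : ℕ} (t : ℝ) (ht : 10000 ≤ t) (hn : (n : ℝ) = t ^ 4)
    (h34 : (n : ℝ) ^ ((3 : ℝ) / 4) = t ^ 3)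
    {Ω : Type} (M : Finset (Fin n) → Ω → Fin n → ℝ) (H : Finset (Fin n)) (ω : Ω)
    (hx : inFam (t ^ 2 / 36) (M H ω)) :
    1 + (t ^ 2 / 36 - 1) * ind (Bev (t ^ 2 / 36) M H ω)
      - ind (Uev M H ω ∧ ¬ Bev (t ^ 2 / 36) M H ω) - 4 * Wd H ^ 2 / t ^ 8
      ≤ mkspan (t ^ 2 / 36) H (M H ω) := by
  have hα : 0 < t ^ 2 / 36 := by positivity
  have hpos := fam_pos hα.le hx
  have hWsq : 0 ≤ 4 * Wd H ^ 2 / t ^ 8 := by positivity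
  have hU0 := ind_nonneg (Uev M H ω ∧ ¬ Bev (t ^ 2 / 36) M H ω)
  have hge : ∀ i, M H ω i / (if i ∈ H then t ^ 2 / 36 else 1) ≤ mkspan (t ^ 2 / 36) H (M H ω) :=
    fun i => le_ciSup (f := fun i => M H ω i / (if i ∈ H then t ^ 2 / 36 else 1))
      (Set.finite_range _).bddAbove i
  have hm0 : 0 ≤ mkspan (t ^ 2 / 36) H (M H ω) := by
    apply Real.iSup_nonneg
    intro i
    have := hpos i
    split_ifs <;> positivity
  by_cases hB : Bev (t ^ 2 / 36) M H ω
  · obtain ⟨i, hi, hi2⟩ := id hB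
    have := hge i
    simp only [hi, if_false, hi2, div_one] at this
    simp only [ind, hB, if_true, not_true, and_false, if_false]
    linarith
  have hb : ind (Bev (t ^ 2 / 36) M H ω) = 0 := by simp [ind, hB]
  rw [hb]
  by_cases hU : Uev M H ω
  · have : ind (Uev M H ω ∧ ¬ Bev (t ^ 2 / 36) M H ω) = 1 := by simp [ind, hB, hU]
    linarith
  have hU' := hU
  unfold Uev at hU'
  rw [h34, not_le] at hU'
  have hBn : ∀ i, M H ω i = t ^ 2 / 36 → i ∈ H := by
    intro i hi; by_contra hc; exact hB ⟨i, hc, hi⟩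
  by_cases hα1 : ∃ i, M H ω i = t ^ 2 / 36
  · obtain ⟨i, hi⟩ := hα1
    have := hge i
    simp only [hBn i hi, if_true, hi, div_self hα.ne'] at this
    linarith
  by_cases h1 : ∃ i, i ∉ H ∧ M H ω i = 1
  · obtain ⟨i, hi, hi2⟩ := h1
    have := hge i
    simp only [hi, if_false, hi2, div_one] at this
    linarith
  push Not at hα1 h1
  have : 1 ≤ 4 * Wd H ^ 2 / t ^ 8 := by
    apply Wd_small t ht hn
    refine lt_of_le_of_lt ?_ hU'
    norm_cast
    apply Finset.card_le_card
    intro i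
    simp only [Finset.mem_filter, Finset.mem_univ, true_and]
    intro hi
    refine ⟨hi, ?_⟩
    have a1 := hα1 i
    have a2 := h1 i hi
    rcases hx with ⟨H', S, hSH, -, -, -, h⟩ | ⟨S, hS, h⟩
    · rw [h i] at a1 a2 ⊢
      split_ifs at a1 a2 ⊢ <;> simp_all
    · rw [h i] at a1 a2 ⊢
      split_ifs at a1 a2 ⊢ <;> simp_all
  linarith

/-- Weighted sum over the product space, normalised. -/
def Ex {n : ℕ} {Ω : Type} [Fintype Ω] (μ : Ω → ℝ) (f : Finset (Fin n) → Ω → ℝ) : ℝ :=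
  (∑ H : Finset (Fin n), ∑ ω : Ω, μ ω * f H ω) / 2 ^ n

section
variable {n : ℕ} {Ω : Type} [Fintype Ω] (μ : Ω → ℝ)

lemma Ex_mono (h0 : ∀ ω, 0 ≤ μ ω) {f g : Finset (Fin n) → Ω → ℝ} (h : ∀ H ω, f H ω ≤ g H ω) :
    Ex μ f ≤ Ex μ g := by
  unfold Ex
  gcongr with H _ ω _
  · exact h0 ω
  · exact h H ω

lemma Ex_add (f g : Finset (Fin n) → Ω → ℝ) :
    Ex μ (fun H ω => f H ω + g H ω) = Ex μ f + Ex μ g := by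
  simp only [Ex, mul_add, Finset.sum_add_distrib, add_div]

lemma Ex_smul (c : ℝ) (f : Finset (Fin n) → Ω → ℝ) :
    Ex μ (fun H ω => c * f H ω) = c * Ex μ f := by
  simp only [Ex, mul_left_comm _ c, ← Finset.mul_sum, mul_div_assoc]

lemma Ex_det (h1 : ∑ ω, μ ω = 1) (f : Finset (Fin n) → ℝ) :
    Ex μ (fun H _ => f H) = (∑ H, f H) / 2 ^ n := by
  simp only [Ex, ← Finset.sum_mul, h1, one_mul]

lemma Ex_const (h1 : ∑ ω, μ ω = 1) (c : ℝ) :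
    Ex μ (fun (_ : Finset (Fin n)) _ => c) = c := by
  rw [Ex_det μ h1]; simp

lemma Ex_W (h1 : ∑ ω, μ ω = 1) : Ex μ (fun (H : Finset (Fin n)) _ => Wd H) = 0 := by
  rw [Ex_det μ h1, Wd_sum, zero_div]

lemma Ex_Wsq (h1 : ∑ ω, μ ω = 1) : Ex μ (fun (H : Finset (Fin n)) _ => Wd H ^ 2) = n := by
  rw [Ex_det μ h1 (fun H => Wd H ^ 2), Wd_sq]; field_simp

lemma Ex_D (M : Finset (Fin n) → Ω → Fin n → ℝ) (h : ∀ i, eLow μ M i ≤ eHigh μ M i) :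
    Ex μ (fun H ω => ∑ i, sg H i * M H ω i) ≤ 0 := by
  unfold Ex
  apply div_nonpos_of_nonpos_of_nonneg _ (by positivity)
  have e : (∑ H : Finset (Fin n), ∑ ω : Ω, μ ω * ∑ i, sg H i * M H ω i) =
      ∑ i, ∑ H : Finset (Fin n), sg H i * ∑ ω : Ω, μ ω * M H ω i := by
    symm
    rw [Finset.sum_comm]
    refine Finset.sum_congr rfl fun H _ => ?_
    simp only [Finset.mul_sum]
    rw [Finset.sum_comm]
    refine Finset.sum_congr rfl fun i _ => Finset.sum_congr rfl fun ω _ => ?_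
    ring
  rw [e]
  apply Finset.sum_nonpos
  intro i _
  have hi := h i
  unfold eLow eHigh at hi
  rw [div_le_div_iff_of_pos_right (by positivity)] at hi
  rw [← Finset.sum_filter_add_sum_filter_not Finset.univ (fun H : Finset (Fin n) => i ∈ H)]
  have e1 : ∑ H ∈ Finset.univ.filter (fun H : Finset (Fin n) => i ∈ H),
      sg H i * ∑ ω : Ω, μ ω * M H ω i = - ∑ H ∈ Finset.univ.filter (fun H : Finset (Fin n) => i ∈ H),
      ∑ ω : Ω, μ ω * M H ω i := by
    rw [← Finset.sum_neg_distrib]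
    refine Finset.sum_congr rfl fun H hH => ?_
    simp only [Finset.mem_filter, Finset.mem_univ, true_and] at hH
    rw [sg, if_pos hH]; ring
  have e2 : ∑ H ∈ Finset.univ.filter (fun H : Finset (Fin n) => i ∉ H),
      sg H i * ∑ ω : Ω, μ ω * M H ω i = ∑ H ∈ Finset.univ.filter (fun H : Finset (Fin n) => i ∉ H),
      ∑ ω : Ω, μ ω * M H ω i := by
    refine Finset.sum_congr rfl fun H hH => ?_
    simp only [Finset.mem_filter, Finset.mem_univ, true_and] at hH
    rw [sg, if_neg hH]; ring
  rw [e1, e2]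
  linarith

end

lemma u_small (t : ℝ) (ht : 10000 ≤ t) : Real.log 4 * Real.exp (-t / 2) ≤ 16 / t ^ 2 := by
  have h4 : Real.log 4 ≤ 2 := by
    have : (4:ℝ) = 2 ^ 2 := by norm_num
    rw [this, Real.log_pow]
    have := Real.log_two_lt_d9
    push_cast; linarith
  have he : t ^ 2 / 8 ≤ Real.exp (t / 2) := by
    have := Real.quadratic_le_exp_of_nonneg (x := t / 2) (by linarith)
    nlinarith
  have he2 : Real.exp (-t / 2) ≤ 8 / t ^ 2 := by
    rw [neg_div, Real.exp_neg]
    calc (Real.exp (t / 2))⁻¹ ≤ (t ^ 2 / 8)⁻¹ := by gcongr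
      _ = 8 / t ^ 2 := by rw [inv_div]
  calc Real.log 4 * Real.exp (-t / 2) ≤ 2 * (8 / t ^ 2) := by
        gcongr
    _ = 16 / t ^ 2 := by ring

lemma core {n : ℕ} (t : ℝ) (ht : 10000 ≤ t) (hn : (n : ℝ) = t ^ 4)
    (h34 : (n : ℝ) ^ ((3 : ℝ) / 4) = t ^ 3) (h12 : (n : ℝ) ^ ((1 : ℝ) / 2) = t ^ 2)
    {Ω : Type} [Fintype Ω] (μ : Ω → ℝ) (h0 : ∀ ω, 0 ≤ μ ω) (h1 : ∑ ω, μ ω = 1)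
    (M : Finset (Fin n) → Ω → Fin n → ℝ)
    (hx : ∀ H ω, inFam (t ^ 2 / 36) (M H ω))
    (hu : ∀ H : Finset (Fin n), (∑ ω : Ω, μ ω * ind (Uev M H ω ∧ ¬Bev (t ^ 2 / 36) M H ω))
          ≤ 16 / t ^ 2)
    (hm : ∀ i : Fin n, eLow μ M i ≤ eHigh μ M i) :
    2 / t ≤ prB (t ^ 2 / 36) μ M ∧
    1 + (t ^ 2 / 36 - 1) * prB (t ^ 2 / 36) μ M - 1 / t ≤ expMk (t ^ 2 / 36) μ M := by
  have hp : prB (t ^ 2 / 36) μ M = Ex μ (fun H ω => ind (Bev (t ^ 2 / 36) M H ω)) := rfl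
  have hmk : expMk (t ^ 2 / 36) μ M = Ex μ (fun H ω => mkspan (t ^ 2 / 36) H (M H ω)) := rfl
  set p := prB (t ^ 2 / 36) μ M
  set u := Ex μ (fun H ω => ind (Uev M H ω ∧ ¬Bev (t ^ 2 / 36) M H ω)) with hud
  have hu1 : u ≤ 16 / t ^ 2 := by
    rw [hud, Ex, div_le_iff₀ (by positivity)]
    refine (Finset.sum_le_sum fun H _ => hu H).trans ?_
    simp [mul_comm]
  have hW : Ex μ (fun (H : Finset (Fin n)) _ => (4 / t ^ 8) * Wd H ^ 2) = 4 / t ^ 4 := by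
    rw [Ex_smul, Ex_Wsq μ h1, hn]; field_simp
  have hsm : 16 / t ^ 2 + 4 / t ^ 4 ≤ 1 / t := by
    rw [div_add_div _ _ (by positivity) (by positivity), div_le_div_iff₀ (by positivity) (by positivity)]
    have : 0 < t ^ 5 := by positivity
    have h2 : t ^ 3 ≤ t ^ 5 := pow_le_pow_right₀ (by linarith) (by norm_num)
    nlinarith [mul_le_mul_of_nonneg_right ht this.le]
  constructor
  · have hD := Ex_D μ M hm
    have key := Ex_mono μ h0 (fun H ω => pointwise t ht hn h34 h12 M H ω (hx H ω))
    have e : Ex μ (fun (H : Finset (Fin n)) ω => Wd H + 17 / 36 * t ^ 4 - 3 * t ^ 3 - (t ^ 5 / 36 + 2 * t ^ 4) *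
      (ind (Bev (t ^ 2 / 36) M H ω) + ind (Uev M H ω ∧ ¬ Bev (t ^ 2 / 36) M H ω) +
        4 * Wd H ^ 2 / t ^ 8)) = (17 / 36 * t ^ 4 - 3 * t ^ 3) - (t ^ 5 / 36 + 2 * t ^ 4) *
        (p + u + 4 / t ^ 4) := by
      have : ∀ (H : Finset (Fin n)) ω, Wd H + 17 / 36 * t ^ 4 - 3 * t ^ 3 - (t ^ 5 / 36 + 2 * t ^ 4) *
      (ind (Bev (t ^ 2 / 36) M H ω) + ind (Uev M H ω ∧ ¬ Bev (t ^ 2 / 36) M H ω) +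
        4 * Wd H ^ 2 / t ^ 8) = Wd H + (17 / 36 * t ^ 4 - 3 * t ^ 3) + (-(t ^ 5 / 36 + 2 * t ^ 4)) *
      (ind (Bev (t ^ 2 / 36) M H ω) + ind (Uev M H ω ∧ ¬ Bev (t ^ 2 / 36) M H ω) +
        (4 / t ^ 8) * Wd H ^ 2) := by intros; ring
      simp only [this]
      rw [Ex_add, Ex_add, Ex_smul, Ex_add, Ex_add, hW, Ex_W μ h1, Ex_const μ h1, ← hp, ← hud]
      ring
    rw [e] at key
    have k2 := key.trans hD
    have k3 : (t ^ 5 / 36 + 2 * t ^ 4) * (p + u + 4 / t ^ 4) ≤ (t ^ 5 / 36 + 2 * t ^ 4) * (p + 1 / t) := by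
      apply mul_le_mul_of_nonneg_left _ (by positivity)
      linarith
    have k4 : (17 / 36 * t ^ 4 - 3 * t ^ 3) ≤ (t ^ 5 / 36 + 2 * t ^ 4) * (p + 1 / t) := by linarith
    by_contra hc
    push Not at hc
    have k5 : (t ^ 5 / 36 + 2 * t ^ 4) * (p + 1 / t) ≤ (t ^ 5 / 36 + 2 * t ^ 4) * (3 / t) := by
      gcongr
      have : 3 / t = 2 / t + 1 / t := by ring
      linarith
    have k6 : (t ^ 5 / 36 + 2 * t ^ 4) * (3 / t) = t ^ 4 / 12 + 6 * t ^ 3 := by field_simp; ring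
    have : 0 < t ^ 3 := by positivity
    nlinarith [mul_le_mul_of_nonneg_right ht this.le]
  · have key := Ex_mono μ h0 (fun H ω => mk_pointwise t ht hn h34 M H ω (hx H ω))
    rw [← hmk] at key
    refine le_trans ?_ key
    have : ∀ (H : Finset (Fin n)) ω, 1 + (t ^ 2 / 36 - 1) * ind (Bev (t ^ 2 / 36) M H ω)
      - ind (Uev M H ω ∧ ¬ Bev (t ^ 2 / 36) M H ω) - 4 * Wd H ^ 2 / t ^ 8 =
      1 + (t ^ 2 / 36 - 1) * ind (Bev (t ^ 2 / 36) M H ω)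
      + (-1) * ind (Uev M H ω ∧ ¬ Bev (t ^ 2 / 36) M H ω) + (-1) * ((4 / t ^ 8) * Wd H ^ 2) := by
      intros; ring
    simp only [this]
    rw [Ex_add, Ex_add, Ex_add, Ex_smul, Ex_smul, Ex_smul μ (-1), hW, Ex_const μ h1, ← hp, ← hud]
    linarith

theorem stmt12 :
    ∀ ε : ℝ, 0 < ε → ε < 1 →
    ∃ n₀ : ℕ, ∀ n : ℕ, n₀ ≤ n →
    ∀ (Ω : Type) [Fintype Ω], ∀ μ : Ω → ℝ,
      (∀ ω, 0 ≤ μ ω) → (∑ ω, μ ω) = 1 →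
    ∀ M : Finset (Fin n) → Ω → Fin n → ℝ,
      (∀ H ω, inFam ((n : ℝ) ^ ((1 : ℝ) / 2) / 36) (M H ω)) →
      (∀ H : Finset (Fin n),
        (∑ ω : Ω, μ ω *
            ind (Uev M H ω ∧ ¬Bev ((n : ℝ) ^ ((1 : ℝ) / 2) / 36) M H ω))
          ≤ Real.log 4 * Real.exp (-(n : ℝ) ^ ((1 : ℝ) / 4) / 2)) →
      (∀ i : Fin n, eLow μ M i ≤ eHigh μ M i) →
      ((n : ℝ) ^ (-(1 : ℝ) / 4) - 2 * Real.exp (-(n : ℝ) ^ ((1 : ℝ) / 4) / 4) -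
          Real.log 4 * Real.exp (-(n : ℝ) ^ ((1 : ℝ) / 4) / 2)
        ≤ prB ((n : ℝ) ^ ((1 : ℝ) / 2) / 36) μ M)
      ∧ (1 + ((n : ℝ) ^ ((1 : ℝ) / 2) / 36) *
            ((n : ℝ) ^ (-(1 : ℝ) / 4) - 2 * Real.exp (-(n : ℝ) ^ ((1 : ℝ) / 4) / 4) -
              Real.log 4 * Real.exp (-(n : ℝ) ^ ((1 : ℝ) / 4) / 2))
          ≤ expMk ((n : ℝ) ^ ((1 : ℝ) / 2) / 36) μ M)
      ∧ ((1 / 36) * (n : ℝ) ^ ((1 : ℝ) / 4) * (1 - ε)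
          ≤ expMk ((n : ℝ) ^ ((1 : ℝ) / 2) / 36) μ M) := by
  intro ε hε hε1
  refine ⟨10 ^ 16, fun n hn Ω _ μ h0 h1 M hx hu hm => ?_⟩
  have hn0 : (0:ℝ) ≤ (n : ℝ) := by positivity
  have hnR : ((10:ℝ) ^ 16) ≤ (n : ℝ) := by exact_mod_cast hn
  obtain ⟨t, htd⟩ : ∃ t : ℝ, t = (n : ℝ) ^ ((1 : ℝ) / 4) := ⟨_, rfl⟩
  have hpw : ∀ k : ℕ, (n : ℝ) ^ ((k : ℝ) / 4) = t ^ k := by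
    intro k
    rw [htd, ← Real.rpow_natCast, ← Real.rpow_mul hn0]
    congr 1; ring
  have hn4 : (n : ℝ) = t ^ 4 := by
    have := hpw 4; norm_num at this; exact this
  have h34 : (n : ℝ) ^ ((3 : ℝ) / 4) = t ^ 3 := by
    have := hpw 3; norm_num at this ⊢; exact this
  have h12 : (n : ℝ) ^ ((1 : ℝ) / 2) = t ^ 2 := by
    have := hpw 2; norm_num at this ⊢; exact this
  have ht0 : 0 ≤ t := by rw [htd]; positivity
  have ht : 10000 ≤ t := by
    rw [hn4] at hnR
    by_contra hc
    push Not at hc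
    have : t ^ 4 < 10000 ^ 4 := by gcongr
    norm_num at this hnR
    linarith
  have hm14 : (n : ℝ) ^ (-(1 : ℝ) / 4) = 1 / t := by
    rw [neg_div, Real.rpow_neg hn0, ← htd, one_div]
  rw [hm14]
  simp only [h12, ← htd] at hx hu ⊢
  have hus := u_small t ht
  have hl4 : 0 ≤ Real.log 4 * Real.exp (-t / 2) :=
    mul_nonneg (Real.log_nonneg (by norm_num)) (Real.exp_pos _).le
  have he4 := Real.exp_pos (-t / 4)
  obtain ⟨c1, c2⟩ := core t ht hn4 h34 h12 μ h0 h1 M hx (fun H => (hu H).trans hus) hm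
  have htp : 0 < t := by linarith
  have hit : 0 < 1 / t := by positivity
  have h2t : 2 / t = 2 * (1 / t) := by ring
  have hα : 4 ≤ t ^ 2 / 36 := by nlinarith
  have c3 : (t ^ 2 / 36 - 1) * (2 * (1 / t)) ≤ (t ^ 2 / 36 - 1) * prB (t ^ 2 / 36) μ M := by
    rw [← h2t]
    exact mul_le_mul_of_nonneg_left c1 (by linarith)
  have c4 : 1 + t ^ 2 / 36 * (1 / t) ≤ expMk (t ^ 2 / 36) μ M := by
    nlinarith
  refine ⟨by linarith, ?_, ?_⟩
  · refine le_trans ?_ c4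
    have : t ^ 2 / 36 * (1 / t - 2 * Real.exp (-t / 4) - Real.log 4 * Real.exp (-t / 2)) ≤
        t ^ 2 / 36 * (1 / t) := by
      gcongr; linarith
    linarith
  · have : t ^ 2 / 36 * (1 / t) = t / 36 := by field_simp
    nlinarith

end
end

section
/- Let ε ∈ (0,1/2), ε' > 0, k ≥ 1, and let h : [0,∞) → [0,∞) be increasing with h(0) = 0, h(1) = 1, h(1+ε') < 1/(1−ε), and h(k) > k/ε. Consider a single agent whose value is 0 with probability 1−ε and 1 with probability ε, and the allocation rule that allocates 1+ε' deterministically at value 0, and at value 1 allocates k with probability 1/k and 0 otherwise. The expected objective E[h(x(w))·w] of this rule equals ε·h(k)/k. Then for every remapping g satisfying properties (P.1) and (P.2), the transformed rule's expected objective satisfies E[h(x(g(w)))·w] = z·h(1+ε') + (ε−z)·h(k)/k < 2ε²·h(k)/k, where z = ε·Pr[g(1) = 0] = (1−ε)·Pr[g(0) = 1]; that is, the objective drops by a factor of at least 1/(2ε). -/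
/-!
Statement 15: a single agent has value `0` with probability `1−ε` and `1` with
probability `ε`; the rule allocates `1+ε'` deterministically at value `0`, and at
value `1` allocates `k` with probability `1/k` and `0` otherwise (so `X(0) = 1+ε'`,
`X(1) = 1`).  The original expected objective `E[h(x(w))·w]` equals `ε·h(k)/k`.
For any remapping `g` (given by `a = Pr[g(0)=1]`, `b = Pr[g(1)=0]`, with exchanged
mass `z = (1−ε)a = εb` — property (P.1)) satisfying property (P.2), the transformed
expected objective equals `z·h(1+ε') + (ε−z)·h(k)/k` and is less than
`2ε²·h(k)/k`.
-/

theorem stmt15 (ε ε' k : ℝ) (h : ℝ → ℝ)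
    (hε0 : 0 < ε) (hε1 : ε < 1 / 2) (hε' : 0 < ε') (hk : 1 ≤ k)
    (hmono : MonotoneOn h (Set.Ici 0)) (h0 : h 0 = 0) (h1 : h 1 = 1)
    (hup : h (1 + ε') < 1 / (1 - ε)) (hlow : k / ε < h k)
    (a b z : ℝ) (ha0 : 0 ≤ a) (ha1 : a ≤ 1) (hb0 : 0 ≤ b) (hb1 : b ≤ 1)
    (hz1 : z = (1 - ε) * a) (hz2 : z = ε * b)
    (hP2 : (1 - a) * (1 + ε') + a * ((1 / k) * k + (1 - 1 / k) * 0)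
      ≤ b * (1 + ε') + (1 - b) * ((1 / k) * k + (1 - 1 / k) * 0)) :
    ((1 - ε) * (h (1 + ε') * 0) + ε * (((1 / k) * h k + (1 - 1 / k) * h 0) * 1)
        = ε * (h k / k))
    ∧ ((1 - ε) * (((1 - a) * h (1 + ε') + a * ((1 / k) * h k + (1 - 1 / k) * h 0)) * 0)
        + ε * ((b * h (1 + ε') + (1 - b) * ((1 / k) * h k + (1 - 1 / k) * h 0)) * 1)
        = z * h (1 + ε') + (ε - z) * (h k / k))
    ∧ (z * h (1 + ε') + (ε - z) * (h k / k) < 2 * ε ^ 2 * (h k / k)) := by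
  have hk0 : 0 < k := by linarith
  have hkk : (1 / k) * k = 1 := by field_simp
  rw [hkk] at hP2
  have hab : 1 ≤ a + b := by
    by_contra hc
    push Not at hc
    nlinarith [mul_pos hε' (sub_pos.mpr hc)]
  refine ⟨?_, ?_, ?_⟩
  · rw [h0]; ring
  · rw [h0, hz2]; ring
  · have hH : 1 < ε * (h k / k) := by
      rw [div_lt_iff₀ hε0] at hlow
      rw [← mul_div_assoc, lt_div_iff₀ hk0]
      linarith
    generalize h k / k = H at hH ⊢
    have h1ε : 0 < 1 - ε := by linarith
    have hu : h (1 + ε') * (1 - ε) < 1 := by rwa [lt_div_iff₀ h1ε] at hup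
    generalize h (1 + ε') = u at hu hup ⊢
    have hz : ε * (1 - ε) ≤ z := by
      have e : z = ε * (1 - ε) * (a + b) := by
        linear_combination ε * hz1 + (1 - ε) * hz2
      rw [e]
      nlinarith [mul_pos hε0 h1ε]
    have hu2 : u < 2 := by
      have : 1 / (1 - ε) < 2 := by rw [div_lt_iff₀ h1ε]; linarith
      linarith
    have hH2 : 2 < H := by
      by_contra hc
      push Not at hc
      nlinarith
    nlinarith [mul_nonneg (sub_nonneg.mpr hz) (by linarith : (0:ℝ) ≤ H - u),
      mul_pos hε0 (sub_pos.mpr hu), mul_pos hε0 (sub_pos.mpr hH)]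
end

section
/- Let h : [0,∞) → [0,∞) be continuous, strictly increasing, and superlinear (h(x)/x → ∞ as x → ∞), with h(0) = 0 and h(1) = 1. Then for every ε ∈ (0,1/2) there exist a two-point value distribution D for a single agent (value 0 with probability 1−ε, value 1 with probability ε) and an allocation rule with positive expected objective E[h(x(w))·w], such that for every remapping g satisfying properties (P.1) and (P.2), the transformed rule's expected objective is at most 2ε times the original expected objective. -/
/-!
Statement 16: for `h` continuous, strictly increasing, superlinear, with `h(0)=0`,
`h(1)=1`, and any `ε ∈ (0,1/2)`: for the two-point value distribution (value `0`
w.p. `1−ε`, value `1` w.p. `ε`) there is an allocation rule (modelled with a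
two-outcome randomization `(μ, rule)`; `rule w ω` is the allocation at value
`w ∈ {0,1} ≅ Fin 2`) with positive expected objective `E[h(x(w))·w]`, such that for
every remapping `g` (given by `a = Pr[g(0)=1]`, `b = Pr[g(1)=0]`) satisfying
property (P.1) (`(1−ε)a = εb`) and property (P.2) (monotone transformed expected
allocations), the transformed expected objective is at most `2ε` times the original.
-/

theorem stmt16 (h : ℝ → ℝ)
    (hcont : ContinuousOn h (Set.Ici 0))
    (hmono : StrictMonoOn h (Set.Ici 0))
    (hnonneg : ∀ x, 0 ≤ x → 0 ≤ h x)
    (hsuper : Filter.Tendsto (fun x => h x / x) Filter.atTop Filter.atTop)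
    (h0 : h 0 = 0) (h1 : h 1 = 1) :
    ∀ ε : ℝ, 0 < ε → ε < 1 / 2 →
    ∃ (μ : Fin 2 → ℝ) (rule : Fin 2 → Fin 2 → ℝ),
      (∀ ω, 0 ≤ μ ω) ∧ (∑ ω, μ ω = 1) ∧ (∀ w ω, 0 ≤ rule w ω) ∧
      (0 < (1 - ε) * ((∑ ω, μ ω * h (rule 0 ω)) * 0)
            + ε * ((∑ ω, μ ω * h (rule 1 ω)) * 1)) ∧
      (∀ a b : ℝ, 0 ≤ a → a ≤ 1 → 0 ≤ b → b ≤ 1 →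
        -- property (P.1): the value distribution is preserved
        (1 - ε) * a = ε * b →
        -- property (P.2): transformed expected allocations are monotone
        ((1 - a) * (∑ ω, μ ω * rule 0 ω) + a * (∑ ω, μ ω * rule 1 ω)
          ≤ b * (∑ ω, μ ω * rule 0 ω) + (1 - b) * (∑ ω, μ ω * rule 1 ω)) →
        (1 - ε) * (((1 - a) * (∑ ω, μ ω * h (rule 0 ω))
              + a * (∑ ω, μ ω * h (rule 1 ω))) * 0)
          + ε * ((b * (∑ ω, μ ω * h (rule 0 ω))
              + (1 - b) * (∑ ω, μ ω * h (rule 1 ω))) * 1)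
        ≤ 2 * ε * ((1 - ε) * ((∑ ω, μ ω * h (rule 0 ω)) * 0)
            + ε * ((∑ ω, μ ω * h (rule 1 ω)) * 1))) := by
  intro ε hε hε2
  obtain ⟨M, hM, hM1⟩ := ((hsuper.eventually_ge_atTop (2 / ε)).and
    (Filter.eventually_ge_atTop (1 : ℝ))).exists
  have hM0 : 0 < M := by linarith
  have hp : 0 < 1 / (2 * M) := by positivity
  have hp1 : 1 / (2 * M) ≤ 1 := by
    rw [div_le_one (by positivity)]; linarith
  have hpM : 1 / (2 * M) * M = 1 / 2 := by field_simp
  have hH : 1 ≤ ε * (1 / (2 * M) * h M) := by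
    have e : ε * (1 / (2 * M) * h M) = ε / 2 * (h M / M) := by field_simp
    have e2 : ε / 2 * (2 / ε) = 1 := by field_simp
    rw [e, ← e2]
    exact mul_le_mul_of_nonneg_left hM (by positivity)
  generalize 1 / (2 * M) = p at *
  refine ⟨![p, 1 - p], ![![1, 1], ![M, 0]], ?_, ?_, ?_, ?_, ?_⟩
  · intro ω
    fin_cases ω
    · simpa using hp.le
    · simpa using hp1
  · simp
  · intro w ω
    fin_cases w <;> fin_cases ω <;> simp [hM0.le]
  · simp [h0]
    linarith
  · intro a b ha ha1 hb hb1 hP1 hP2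
    simp only [Fin.sum_univ_two, Matrix.cons_val_zero, Matrix.cons_val_one, h0, h1, hpM] at hP2 ⊢
    generalize p * h M = H at *
    have hab : 1 ≤ a + b := by linarith
    have hb2 : 1 - b ≤ ε := by nlinarith
    have hHpos : 0 < H := by
      by_contra hc
      nlinarith
    have h2 : (1 - b) * H ≤ ε * H := mul_le_mul_of_nonneg_right hb2 hHpos.le
    have h3 : b + (1 - b) * H ≤ 2 * ε * H := by linarith
    have h4 := mul_le_mul_of_nonneg_left h3 hε.le
    linarith
end

section
/- Let h : [0,∞) → [0,∞) be continuous, strictly increasing, and superlinear (h(x)/x → ∞ as x → ∞), with h(0) = 0 and h(1) = 1, and let h' be a continuous strictly decreasing positive function on an interval of values whose range includes (0,1]. Then for every ε ∈ (0,1) there exist a two-point uniform value distribution D for a single agent and an allocation rule, such that for every remapping g satisfying properties (P.1) and (P.2), the transformed rule's expected objective E[h(x(g(w)))·h'(w)] is at least 1/(8ε) times the original expected objective E[h(x(w))·h'(w)]. -/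
/-!
Statement 19: for `h` continuous, strictly increasing, superlinear, with `h(0)=0`,
`h(1)=1`, and `h'` continuous, strictly decreasing and positive on an interval `I`
whose image under `h'` contains `(0,1]`: for every `ε ∈ (0,1)` there are two values
`v1 < v2` in `I` and an allocation rule (modelled with a two-outcome randomization
`(μ, rule)`; `rule 0` is the allocation distribution at `v1` and `rule 1` at `v2`,
the value distribution being uniform on `{v1,v2}`), such that for every remapping
`g` with swap probability `z = Pr[g(v1)=v2] = Pr[g(v2)=v1]` (property (P.1))
satisfying property (P.2), the transformed expected objective
`E[h(x(g(w)))·h'(w)]` is at least `1/(8ε)` times the original expected objective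
`E[h(x(w))·h'(w)]`.
-/

theorem stmt19 (h h' : ℝ → ℝ) (I : Set ℝ) (hI : I.OrdConnected)
    (hcont : ContinuousOn h (Set.Ici 0))
    (hmono : StrictMonoOn h (Set.Ici 0))
    (hnonneg : ∀ x, 0 ≤ x → 0 ≤ h x)
    (hsuper : Filter.Tendsto (fun x => h x / x) Filter.atTop Filter.atTop)
    (h0 : h 0 = 0) (h1 : h 1 = 1)
    (h'cont : ContinuousOn h' I) (h'anti : StrictAntiOn h' I)
    (h'pos : ∀ x ∈ I, 0 < h' x) (h'range : Set.Ioc (0 : ℝ) 1 ⊆ h' '' I) :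
    ∀ ε : ℝ, 0 < ε → ε < 1 →
    ∃ v1 ∈ I, ∃ v2 ∈ I, v1 < v2 ∧
    ∃ (μ : Fin 2 → ℝ) (rule : Fin 2 → Fin 2 → ℝ),
      (∀ ω, 0 ≤ μ ω) ∧ (∑ ω, μ ω = 1) ∧ (∀ w ω, 0 ≤ rule w ω) ∧
      (∀ z : ℝ, 0 ≤ z → z ≤ 1 →
        -- property (P.2): transformed expected allocations are monotone
        ((1 - z) * (∑ ω, μ ω * rule 0 ω) + z * (∑ ω, μ ω * rule 1 ω)
          ≤ z * (∑ ω, μ ω * rule 0 ω) + (1 - z) * (∑ ω, μ ω * rule 1 ω)) →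
        (1 / (8 * ε)) *
            ((1 / 2) * ((∑ ω, μ ω * h (rule 0 ω)) * h' v1)
              + (1 / 2) * ((∑ ω, μ ω * h (rule 1 ω)) * h' v2))
          ≤ (1 / 2) * (((1 - z) * (∑ ω, μ ω * h (rule 0 ω))
                + z * (∑ ω, μ ω * h (rule 1 ω))) * h' v1)
            + (1 / 2) * ((z * (∑ ω, μ ω * h (rule 0 ω))
                + (1 - z) * (∑ ω, μ ω * h (rule 1 ω))) * h' v2)) := by
  intro ε hε hε1
  obtain ⟨v1, hv1, e1⟩ := h'range (⟨one_pos, le_refl 1⟩ : (1 : ℝ) ∈ Set.Ioc (0 : ℝ) 1)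
  obtain ⟨v2, hv2, e2⟩ := h'range (⟨hε, hε1.le⟩ : ε ∈ Set.Ioc (0 : ℝ) 1)
  have hlt : v1 < v2 := by
    by_contra hc
    have := h'anti.antitoneOn hv2 hv1 (not_lt.mp hc)
    rw [e1, e2] at this
    linarith
  obtain ⟨M, hM1, hM⟩ := ((Filter.eventually_ge_atTop (1 : ℝ)).and
    (hsuper.eventually_ge_atTop (2 / (3 * ε)))).exists
  have hM0 : 0 < M := by linarith
  refine ⟨v1, hv1, v2, hv2, hlt, ![1 / (2 * M), 1 - 1 / (2 * M)], ![![1, 1], ![M, 0]],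
    ?_, ?_, ?_, ?_⟩
  · have : 1 / (2 * M) ≤ 1 := by
      rw [div_le_one (by positivity)]; linarith
    intro ω
    fin_cases ω
    · simp; positivity
    · simpa using this
  · simp [Fin.sum_univ_two]
  · intro w ω
    fin_cases w <;> fin_cases ω <;> simp [hM0.le]
  · intro z hz0 hz1 hP
    simp only [Fin.sum_univ_two, Matrix.cons_val_zero, Matrix.cons_val_one, h0, h1, e1, e2]
      at hP ⊢
    have eA : 1 / (2 * M) * M = 1 / 2 := by field_simp
    have eK : 1 / (2 * M) * h M = (h M / M) / 2 := by field_simp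
    rw [eA] at hP
    rw [eK]
    have hz : 1 / 2 ≤ z := by linarith
    generalize h M / M = K at *
    have hK0 : 0 < K := lt_of_lt_of_le (by positivity) hM
    have hK : 1 / (8 * ε) ≤ 3 * K / 16 := by
      have : 1 / (8 * ε) = 3 / 16 * (2 / (3 * ε)) := by field_simp; norm_num
      rw [this]; linarith
    have e8 : 1 / (8 * ε) * ε = 1 / 8 := by field_simp
    have hL : 1 / (8 * ε) * (1 / 2 + 1 / 2 * (K / 2 * ε)) = 1 / (8 * ε) / 2 + K / 32 := by
      linear_combination (K / 4) * e8
    have t1 : 1 / 2 * K ≤ z * K := mul_le_mul_of_nonneg_right hz hK0.le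
    have t2 : 0 ≤ (z + (1 - z) * (K / 2)) * ε := by
      have : 0 ≤ 1 - z := by linarith
      positivity
    ring_nf at hL t2 hK ⊢
    nlinarith
end
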